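/- arXiv:1806.08849 — 3 statements merged into one kernel-verified Lean document; each statement's English description precedes it below -/
import Mathlib

section
/- For every positive integer k there exists N₀ = N₀(k) such that for every integer B ≥ N₀ there exists D₀ = D₀(B, k) with the following property: for every red–blue colouring of ℤ containing no (2,k)-AP and every integer d ≥ 1 such that [0, d] is a gap, there exist integers ℓ, m ≥ B such that d[−ℓ, m] is an extendable table and every red integer in the interval [−ℓd, md] is of the form r·d for some rational number r whose denominator (in lowest terms) is at most D₀. -/
/-- A red–blue colouring of ℤ (red set `R`, blue its complement) contains an `(a,b)`-AP:
an arithmetic progression `x, x+d, …, x+(a+b−1)d` with `d ≠ 0` whose first `a` terms are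
red and whose last `b` terms are blue. -/
def HasAPZ (R : Set ℤ) (a b : ℕ) : Prop :=
  ∃ x d : ℤ, d ≠ 0 ∧
    (∀ i : ℕ, i < a → x + (i : ℤ) * d ∈ R) ∧
    (∀ i : ℕ, a ≤ i → i < a + b → x + (i : ℤ) * d ∉ R)

/-- `[u, v]` is a gap: `u < v`, `u` and `v` are red, and all integers strictly between
`u` and `v` are blue. -/
def IsGap (R : Set ℤ) (u v : ℤ) : Prop :=
  u < v ∧ u ∈ R ∧ v ∈ R ∧ ∀ n : ℤ, u < n → n < v → n ∉ R

/-- The set `d[−ℓ, m] = {dn : −ℓ ≤ n ≤ m}` is a table with respect to `k`: `−ℓd` and `md`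
are both red, and every gap `n₁ < n₂` of `d[−ℓ, m]` (i.e. `dn₁, dn₂` red and `dn` blue
for `n₁ < n < n₂`) satisfies `n₂ − n₁ ≤ (m + ℓ)/(k+1)`. -/
def IsTable (R : Set ℤ) (k : ℕ) (d ℓ m : ℤ) : Prop :=
  (-ℓ * d ∈ R) ∧ (m * d ∈ R) ∧
  ∀ n₁ n₂ : ℤ, -ℓ ≤ n₁ → n₁ < n₂ → n₂ ≤ m →
    n₁ * d ∈ R → n₂ * d ∈ R → (∀ n : ℤ, n₁ < n → n < n₂ → n * d ∉ R) →
    ((n₂ - n₁ : ℚ) ≤ (m + ℓ) / (k + 1))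

/-- A table `d[−ℓ, m]` is extendable if for all `ℓ' ≥ ℓ` and `m' ≥ m` with `−ℓ'd` and
`m'd` both red, `d[−ℓ', m']` is also a table. -/
def ExtendableTable (R : Set ℤ) (k : ℕ) (d ℓ m : ℤ) : Prop :=
  IsTable R k d ℓ m ∧
  ∀ ℓ' m' : ℤ, ℓ ≤ ℓ' → m ≤ m' → -ℓ' * d ∈ R → m' * d ∈ R → IsTable R k d ℓ' m'

/-- The positive form of having no `(2,k)`-AP. -/
def GoodSet (R : Set ℤ) (k : ℕ) : Prop :=
  ∀ u v : ℤ, u ∈ R → v ∈ R → u ≠ v → ∃ s : ℤ, 2 ≤ s ∧ s ≤ k + 1 ∧ u + s * (v - u) ∈ R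

lemma goodSet_of_noAP {R : Set ℤ} {k : ℕ} (h : ¬ HasAPZ R 2 k) : GoodSet R k := by
  intro u v hu hv huv
  by_contra hcon
  push Not at hcon
  apply h
  refine ⟨u, v - u, sub_ne_zero.mpr (Ne.symm huv), ?_, ?_⟩
  · intro i hi
    interval_cases i
    · simpa using hu
    · simpa using hv
  · intro i h2 hi
    exact hcon i (by exact_mod_cast h2) (by push_cast; omega)

lemma GoodSet.affine {R : Set ℤ} {k : ℕ} (h : GoodSet R k) (c e : ℤ) (he : e ≠ 0) :
    GoodSet {n : ℤ | c + n * e ∈ R} k := by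
  intro u v hu hv huv
  obtain ⟨s, h2, hk, hs⟩ := h _ _ hu hv (by
    intro hh
    exact huv (mul_right_cancel₀ he (add_left_cancel hh)))
  refine ⟨s, h2, hk, ?_⟩
  show c + (u + s * (v - u)) * e ∈ R
  convert hs using 1
  ring

lemma GoodSet.exists_next {R : Set ℤ} {k : ℕ} (h : GoodSet R k) (a : ℤ) (ha : a ∈ R) (x : ℤ) :
    ∀ (n : ℕ) (a' : ℤ), a' ∈ R → a < a' → a' - a ≤ x → x - (a' - a) ≤ n →
      ∃ b ∈ R, a + x < b ∧ b ≤ a + (k + 1) * x := by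
  intro n
  induction n with
  | zero =>
    intro a' ha' hlt hle hn
    obtain ⟨s, h2, hk, hs⟩ := h a a' ha ha' hlt.ne
    have : a' - a = x := by push_cast at hn; omega
    rw [this] at hs
    refine ⟨_, hs, ?_, ?_⟩ <;> nlinarith
  | succ n ih =>
    intro a' ha' hlt hle hn
    obtain ⟨s, h2, hk, hs⟩ := h a a' ha ha' hlt.ne
    by_cases hb : a + s * (a' - a) - a ≤ x
    · refine ih _ hs ?_ hb ?_
      · nlinarith
      · push_cast at hn
        nlinarith
    · refine ⟨_, hs, ?_, ?_⟩
      · linarith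
      · have h1 : s * (a' - a) ≤ (k + 1) * (a' - a) :=
          mul_le_mul_of_nonneg_right hk (by linarith)
        have h3 : ((k : ℤ) + 1) * (a' - a) ≤ (k + 1) * x :=
          mul_le_mul_of_nonneg_left hle (by positivity)
        linarith

lemma GoodSet.cluster {R : Set ℤ} {k : ℕ} (h : GoodSet R k) (a a' : ℤ) (ha : a ∈ R)
    (ha' : a' ∈ R) (hlt : a < a') :
    ∃ f : ℕ → ℤ, StrictMono f ∧ ∀ i, f i ∈ R ∧ a < f i ∧
      f i - a ≤ ((k : ℤ) + 1) ^ i * (a' - a) := by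
  have key : ∀ b : {b : ℤ // b ∈ R ∧ a < b}, ∃ b' : {b : ℤ // b ∈ R ∧ a < b},
      b.1 < b'.1 ∧ b'.1 - a ≤ (k + 1) * (b.1 - a) := by
    rintro ⟨b, hb, hab⟩
    obtain ⟨s, h2, hk, hs⟩ := h a b ha hb hab.ne
    refine ⟨⟨_, hs, ?_⟩, ?_, ?_⟩
    · nlinarith
    · show b < a + s * (b - a)
      nlinarith
    · show a + s * (b - a) - a ≤ _
      have := mul_le_mul_of_nonneg_right hk (show 0 ≤ b - a by linarith)
      linarith
  choose g hg1 hg2 using key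
  let F : ℕ → {b : ℤ // b ∈ R ∧ a < b} := fun i => g^[i] ⟨a', ha', hlt⟩
  have hF : ∀ i, F (i + 1) = g (F i) := fun i => Function.iterate_succ_apply' _ _ _
  refine ⟨fun i => (F i).1, strictMono_nat_of_lt_succ ?_, ?_⟩
  · intro i
    show (F i).1 < (F (i + 1)).1
    rw [hF]
    exact hg1 _
  · intro i
    refine ⟨(F i).2.1, (F i).2.2, ?_⟩
    induction i with
    | zero => simp [F]
    | succ i ih =>
      show (F (i + 1)).1 - a ≤ _
      rw [hF]
      have h1 := hg2 (F i)
      have h2 := mul_le_mul_of_nonneg_left ih (show (0 : ℤ) ≤ k + 1 by positivity)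
      calc _ ≤ _ := h1
        _ ≤ _ := h2
        _ = _ := by ring

/-- A close pair of red points left of a blue interval of length more than `(k+1)^2 x`
gives another fairly close pair, at least `x` further to the right. -/
lemma GoodSet.step {R : Set ℤ} {k : ℕ} (h : GoodSet R k) (a a' n₁ n₂ x : ℤ)
    (ha : a ∈ R) (ha' : a' ∈ R) (hlt : a < a') (han : a ≤ n₁)
    (hblue : ∀ n, n₁ < n → n < n₂ → n ∉ R) (hx : ((k : ℤ) + 1) ^ 2 * x < n₂ - n₁)
    (hs : ((k : ℤ) + 1) ^ k * (a' - a) ≤ x) :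
    ∃ e e' : ℤ, e ∈ R ∧ e' ∈ R ∧ e < e' ∧ e' ≤ n₁ ∧ a + x < e ∧
      e' - e ≤ ((k : ℤ) + 1) ^ (k + 1) * (a' - a) := by
  obtain ⟨f, hf, hfa⟩ := h.cluster a a' ha ha' hlt
  have hpow : ∀ i ≤ k, ((k : ℤ) + 1) ^ i * (a' - a) ≤ ((k : ℤ) + 1) ^ k * (a' - a) := by
    intro i hi
    exact mul_le_mul_of_nonneg_right (pow_le_pow_right₀ (by linarith [Int.natCast_nonneg k]) hi)
      (by linarith)
  have h0 : a' - a ≤ x := by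
    have := hpow 0 (Nat.zero_le _)
    simp at this
    linarith
  obtain ⟨b, hb, hb1, hb2⟩ := h.exists_next a ha x (x - (a' - a)).toNat a' ha' hlt h0 (by omega)
  have hfb : ∀ i ≤ k, f i < b := by
    intro i hi
    have := hpow i hi
    have := (hfa i).2.2
    linarith
  have key : ∀ i : Fin (k + 1), ∃ s : ℤ, (2 ≤ s ∧ s ≤ k + 1) ∧ f i + s * (b - f i) ∈ R := by
    intro i
    obtain ⟨s, h2, hk, hs⟩ := h (f i) b (hfa i).1 hb (hfb i (by omega)).ne
    exact ⟨s, ⟨h2, hk⟩, hs⟩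
  choose s hs2 hsR using key
  obtain ⟨i, -, j, -, hij, hsij⟩ := Finset.exists_ne_map_eq_of_card_lt_of_maps_to
    (s := (Finset.univ : Finset (Fin (k + 1)))) (t := Finset.Icc (2 : ℤ) (k + 1)) (f := s)
    (by simp) (by intro i _; simpa using hs2 i)
  wlog hlt' : i < j generalizing i j
  · exact this j i hij.symm hsij.symm (lt_of_le_of_ne (not_lt.mp hlt') hij.symm)
  have hfij : f i < f j := hf hlt'
  have bound : ∀ i : Fin (k + 1), a + x < f i + s i * (b - f i) ∧ f i + s i * (b - f i) ≤ n₁ := by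
    intro i
    have h1 := hfb i (by omega)
    have h2 := hfa i
    have h3 := hs2 i
    have hA : a + x < f i + s i * (b - f i) := by nlinarith
    refine ⟨hA, ?_⟩
    by_contra hc
    refine hblue _ (not_le.mp hc) ?_ (hsR i)
    have e1 : s i * (b - f i) ≤ (k + 1) * (b - f i) :=
      mul_le_mul_of_nonneg_right h3.2 (by linarith)
    have e2 : (k : ℤ) * (b - f i) ≤ k * (b - a) :=
      mul_le_mul_of_nonneg_left (by linarith) (by positivity)
    have e3 : ((k : ℤ) + 1) * (b - a) ≤ (k + 1) * ((k + 1) * x) :=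
      mul_le_mul_of_nonneg_left (by linarith) (by positivity)
    nlinarith
  refine ⟨_, _, hsR j, hsR i, ?_, (bound i).2, (bound j).1, ?_⟩
  · rw [← hsij]
    nlinarith [hs2 i]
  · rw [← hsij]
    have e1 : f j - f i ≤ ((k : ℤ) + 1) ^ k * (a' - a) := by
      have := hpow j (by omega)
      linarith [(hfa j).2.2, (hfa i).2.1]
    have e2 : (s i - 1) * (f j - f i) ≤ (k + 1) * (((k : ℤ) + 1) ^ k * (a' - a)) :=
      mul_le_mul (by linarith [(hs2 i).2]) e1 (by linarith) (by positivity)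
    calc _ = (s i - 1) * (f j - f i) := by ring
      _ ≤ _ := e2
      _ = _ := by ring

lemma GoodSet.no_gap {R : Set ℤ} {k : ℕ} (h : GoodSet R k) (n₁ n₂ x : ℤ)
    (hblue : ∀ n, n₁ < n → n < n₂ → n ∉ R) (hx : ((k : ℤ) + 1) ^ 2 * x < n₂ - n₁) :
    ∀ (J : ℕ) (a a' : ℤ), a ∈ R → a' ∈ R → a < a' → a' ≤ n₁ → n₁ - a ≤ J * x →
      (((k : ℤ) + 1) ^ (k + 1)) ^ (J + 1) * (a' - a) ≤ x → False := by
  intro J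
  have hC1 : (1 : ℤ) ≤ ((k : ℤ) + 1) ^ (k + 1) :=
    one_le_pow₀ (by linarith [Int.natCast_nonneg k])
  induction J with
  | zero =>
    intro a a' _ _ hlt hle hn _
    simp at hn
    linarith
  | succ J ih =>
    intro a a' ha ha' hlt hle hn hs
    have hC : ((k : ℤ) + 1) ^ k ≤ ((k : ℤ) + 1) ^ (k + 1) :=
      pow_le_pow_right₀ (by linarith [Int.natCast_nonneg k]) (Nat.le_succ k)
    have hC' : ((k : ℤ) + 1) ^ (k + 1) ≤ (((k : ℤ) + 1) ^ (k + 1)) ^ (J + 1 + 1) :=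
      le_self_pow₀ hC1 (by omega)
    obtain ⟨e, e', he, he', hee, hen, hae, hd⟩ := h.step a a' n₁ n₂ x ha ha' hlt (by linarith)
      hblue hx ((mul_le_mul_of_nonneg_right (hC.trans hC') (by linarith)).trans hs)
    refine ih e e' he he' hee hen ?_ ?_
    · push_cast at hn
      linarith
    · refine le_trans (mul_le_mul_of_nonneg_left hd (by positivity)) (le_trans (le_of_eq ?_) hs)
      ring

/-- quantitative version: close reds left of a blue interval. -/
lemma GoodSet.sep {R : Set ℤ} {k : ℕ} (h : GoodSet R k) (n₁ n₂ : ℤ) (Q : ℕ)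
    (hblue : ∀ n, n₁ < n → n < n₂ → n ∉ R) (a a' : ℤ) (ha : a ∈ R) (ha' : a' ∈ R) (hlt : a < a')
    (hle : a' ≤ n₁) (hn : n₁ - a ≤ Q * (n₂ - n₁)) :
    n₂ - n₁ ≤ 2 * ((k : ℤ) + 1) ^ 2 *
      (((k : ℤ) + 1) ^ (k + 1)) ^ (2 * (k + 1) ^ 2 * Q + 1) * (a' - a) := by
  by_contra hcon
  push Not at hcon
  set E : ℤ := (((k : ℤ) + 1) ^ (k + 1)) ^ (2 * (k + 1) ^ 2 * Q + 1) * (a' - a) with hE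
  have hE1 : 0 < E := by
    have : 0 < a' - a := by linarith
    positivity
  set w : ℤ := ((k : ℤ) + 1) ^ 2 with hw
  have hw1 : 0 < w := by positivity
  set g := n₂ - n₁ with hg
  have hcon' : 2 * w * E < g := by rw [hE]; linarith
  have hd := Int.mul_ediv_add_emod (g - 1) w
  have hm1 := Int.emod_lt_of_pos (g - 1) hw1
  have hm0 := Int.emod_nonneg (g - 1) hw1.ne'
  set x := (g - 1) / w with hx
  have hxE : E ≤ x := by
    rw [hx, Int.le_ediv_iff_mul_le hw1]
    nlinarith
  refine h.no_gap n₁ n₂ x hblue (by rw [← hw]; linarith) (2 * (k + 1) ^ 2 * Q) a a' ha ha' hlt hle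
    ?_ hxE
  have hg2 : g ≤ 2 * w * x := by nlinarith
  have : (Q : ℤ) * g ≤ Q * (2 * w * x) := mul_le_mul_of_nonneg_left hg2 (by positivity)
  push_cast
  rw [← hw]
  linarith

/-- The constant. -/
def sepC (k Q : ℕ) : ℕ := 2 * (k + 1) ^ 2 * ((k + 1) ^ (k + 1)) ^ (2 * (k + 1) ^ 2 * Q + 1)

lemma GoodSet.sep' {R : Set ℤ} {k : ℕ} (h : GoodSet R k) (n₁ n₂ : ℤ) (Q : ℕ)
    (hblue : ∀ n, n₁ < n → n < n₂ → n ∉ R) (a a' : ℤ) (ha : a ∈ R) (ha' : a' ∈ R) (hlt : a < a')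
    (hn : (a' ≤ n₁ ∧ n₁ - a ≤ Q * (n₂ - n₁)) ∨ (n₂ ≤ a ∧ a' - n₂ ≤ Q * (n₂ - n₁))) :
    n₂ - n₁ ≤ sepC k Q * (a' - a) := by
  rcases hn with ⟨h1, h2⟩ | ⟨h1, h2⟩
  · have := h.sep n₁ n₂ Q hblue a a' ha ha' hlt h1 h2
    simpa [sepC] using this
  · have h' := h.affine 0 (-1) (by norm_num)
    have := h'.sep (-n₂) (-n₁) Q (by
      intro n hn1 hn2 hn3
      refine hblue (-n) (by linarith) (by linarith) ?_
      simpa using hn3) (-a') (-a) (by simpa using ha') (by simpa using ha) (by linarith)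
      (by linarith) (by linarith)
    simp only [sepC]
    push_cast
    linarith

lemma GoodSet.table {R : Set ℤ} {k : ℕ} (h : GoodSet R k) (d : ℤ) (hd : 1 ≤ d) (h0 : 0 ∈ R)
    (h1 : d ∈ R) (ℓ m : ℤ) (hℓ : ((k + 1) * sepC k (k + 1) : ℤ) ≤ ℓ)
    (hm : ((k + 1) * sepC k (k + 1) : ℤ) ≤ m)
    (hℓR : -ℓ * d ∈ R) (hmR : m * d ∈ R) : IsTable R k d ℓ m := by
  refine ⟨hℓR, hmR, ?_⟩
  intro n₁ n₂ hn1 hlt hn2 hr1 hr2 hb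
  rw [le_div_iff₀ (by positivity)]
  suffices (n₂ - n₁) * (k + 1) ≤ m + ℓ by exact_mod_cast this
  by_contra hcon
  push Not at hcon
  have hT := h.affine 0 d (by linarith)
  have hS : (1 : ℤ) ≤ sepC k (k + 1) := by
    have : 0 < sepC k (k + 1) := by unfold sepC; positivity
    exact_mod_cast this
  have hkS : ((k : ℤ) + 1) * 1 ≤ (k + 1) * sepC k (k + 1) :=
    mul_le_mul_of_nonneg_left hS (by positivity)
  have T0 : (0 : ℤ) ∈ {n : ℤ | 0 + n * d ∈ R} := by simpa using h0
  have T1 : (1 : ℤ) ∈ {n : ℤ | 0 + n * d ∈ R} := by simpa using h1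
  have hcase : 1 ≤ n₁ ∨ n₂ ≤ 0 ∨ n₂ - n₁ ≤ 1 := by
    by_contra hc
    push Not at hc
    by_cases hz : n₁ < 0
    · exact hb 0 hz hc.2.1 (by simpa using h0)
    · exact hb 1 hc.1 (by omega) (by simpa using h1)
  have hfin : n₂ - n₁ ≤ sepC k (k + 1) := by
    rcases hcase with hc | hc | hc
    · have := hT.sep' n₁ n₂ (k + 1) (by intro n a b; simpa using hb n a b) 0 1 T0 T1 one_pos
        (Or.inl ⟨hc, by push_cast; linarith⟩)
      linarith
    · have := hT.sep' n₁ n₂ (k + 1) (by intro n a b; simpa using hb n a b) 0 1 T0 T1 one_pos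
        (Or.inr ⟨hc, by push_cast; linarith⟩)
      linarith
    · linarith
  have : (n₂ - n₁) * (k + 1) ≤ sepC k (k + 1) * (k + 1) :=
    mul_le_mul_of_nonneg_right hfin (by positivity)
  linarith

/-- consecutive elements around a point -/
lemma exists_around (T : Set ℤ) (P : ℤ → Prop) (lo hi : ℤ) (hlo : lo ∈ T) (hhi : hi ∈ T)
    (hP : P lo) (hP' : ¬ P hi) (hmono : ∀ a b, a ≤ b → P b → P a) :
    ∃ n₁ n₂, lo ≤ n₁ ∧ n₁ < n₂ ∧ n₂ ≤ hi ∧ n₁ ∈ T ∧ n₂ ∈ T ∧ P n₁ ∧ ¬ P n₂ ∧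
      ∀ n, n₁ < n → n < n₂ → n ∉ T := by
  have hlh : lo < hi := by
    by_contra hc
    exact hP' (hmono _ _ (not_lt.mp hc) hP)
  obtain ⟨n₁, ⟨h1, h2⟩, h3⟩ := Int.exists_greatest_of_bdd (P := fun n => n ∈ T ∧ P n)
    ⟨hi, fun z hz => by
      by_contra hc
      exact hP' (hmono _ _ (not_le.mp hc).le hz.2)⟩ ⟨lo, hlo, hP⟩
  obtain ⟨n₂, ⟨h4, h5⟩, h6⟩ := Int.exists_least_of_bdd (P := fun n => n ∈ T ∧ ¬ P n)
    ⟨lo, fun z hz => by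
      by_contra hc
      exact hz.2 (hmono _ _ (not_le.mp hc).le hP)⟩ ⟨hi, hhi, hP'⟩
  refine ⟨n₁, n₂, h3 _ ⟨hlo, hP⟩, ?_, h6 _ ⟨hhi, hP'⟩, h1, h4, h2, h5, ?_⟩
  · by_contra hc
    exact h5 (hmono _ _ (not_lt.mp hc) h2)
  · intro n hn1 hn2 hn
    by_cases hp : P n
    · exact absurd (h3 n ⟨hn, hp⟩) (not_le.mpr hn1)
    · exact absurd (h6 n ⟨hn, hp⟩) (not_le.mpr hn2)

/-- The map on reds of a table. -/
lemma GoodSet.move {R : Set ℤ} {k : ℕ} (hk : 0 < k) (h : GoodSet R k) (d : ℤ) (hd : 1 ≤ d)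
    (ℓ m : ℤ) (ht : IsTable R k d ℓ m) (y : ℤ) (hy : y ∈ R) (hy1 : -ℓ * d ≤ y) (hy2 : y ≤ m * d) :
    ∃ y' : ℤ, y' ∈ R ∧ -ℓ * d ≤ y' ∧ y' ≤ m * d ∧
      ∃ c : ℕ, 2 ≤ c ∧ c ≤ k + 1 ∧ d ∣ y' - c * y := by
  by_cases hdy : d ∣ y
  · refine ⟨y, hy, hy1, hy2, 2, le_rfl, by omega, ?_⟩
    exact dvd_sub hdy (Dvd.dvd.mul_left hdy _)
  obtain ⟨hl, hm, hgap⟩ := ht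
  have hne : ∀ n, n * d ≠ y := fun n hn => hdy ⟨n, by linarith⟩
  obtain ⟨n₁, n₂, h1, h2, h3, h4, h5, h6, h7, h8⟩ := exists_around {n : ℤ | n * d ∈ R}
    (fun n => n * d ≤ y) (-ℓ) m hl hm hy1 (by
      intro hc
      exact hne m (le_antisymm hc hy2)) (by
      intro a b hab hb
      exact (mul_le_mul_of_nonneg_right hab (by linarith)).trans hb)
  have hg := hgap n₁ n₂ h1 h2 h3 h4 h5 h8
  rw [le_div_iff₀ (by positivity)] at hg
  have hg' : (n₂ - n₁) * (k + 1) ≤ m + ℓ := by exact_mod_cast hg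
  push Not at h7
  have h6' : n₁ * d < y := lt_of_le_of_ne h6 (hne _)
  have hg2 : (n₂ - n₁) * k * d ≤ (m + ℓ) * d := by
    apply mul_le_mul_of_nonneg_right _ (by linarith)
    linarith
  by_cases hcase : y + k * (y - n₁ * d) ≤ m * d
  · obtain ⟨s, hs2, hsk, hs⟩ := h (n₁ * d) y h4 hy h6'.ne
    have e1 : s * (y - n₁ * d) ≤ (k + 1) * (y - n₁ * d) :=
      mul_le_mul_of_nonneg_right hsk (by linarith)
    refine ⟨_, hs, ?_, ?_, s.toNat, by omega, by omega, ?_⟩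
    · nlinarith
    · linarith
    · rw [Int.toNat_of_nonneg (by linarith)]
      exact ⟨n₁ - s * n₁, by ring⟩
  · obtain ⟨s, hs2, hsk, hs⟩ := h (n₂ * d) y h5 hy h7.ne'
    have e1 : s * (n₂ * d - y) ≤ (k + 1) * (n₂ * d - y) :=
      mul_le_mul_of_nonneg_right hsk (by linarith)
    have e2 : 2 * (n₂ * d - y) ≤ s * (n₂ * d - y) :=
      mul_le_mul_of_nonneg_right hs2 (by linarith)
    refine ⟨_, hs, ?_, ?_, s.toNat, by omega, by omega, ?_⟩
    · push Not at hcase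
      linarith
    · linarith
    · rw [Int.toNat_of_nonneg (by linarith)]
      exact ⟨n₂ - s * n₂, by ring⟩

lemma GoodSet.denominators {R : Set ℤ} {k : ℕ} (hk : 0 < k) (h : GoodSet R k) (d : ℤ) (hd : 1 ≤ d)
    (ℓ m : ℤ) (ht : IsTable R k d ℓ m) (P M : ℕ)
    (hM : (m + ℓ) * P + 1 ≤ M)
    (hsep : ∀ u ∈ R, ∀ v ∈ R, -ℓ * d ≤ u → u < v → v ≤ m * d → d ≤ P * (v - u))
    (y : ℤ) (hy : y ∈ R) (hy1 : -ℓ * d ≤ y) (hy2 : y ≤ m * d) :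
    ∃ q : ℕ, 0 < q ∧ q ≤ (k + 1) ^ M ∧ d ∣ q * y := by
  let S := {z : ℤ // z ∈ R ∧ -ℓ * d ≤ z ∧ z ≤ m * d}
  have key : ∀ z : S, ∃ z' : S, ∃ c : ℕ, 2 ≤ c ∧ c ≤ k + 1 ∧ d ∣ z'.1 - c * z.1 := by
    rintro ⟨z, hz, hz1, hz2⟩
    obtain ⟨z', a, b, c, e⟩ := h.move hk d hd ℓ m ht z hz hz1 hz2
    exact ⟨⟨z', a, b, c⟩, e⟩
  choose g c hc2 hck hdvd using key
  let F : ℕ → S := fun i => g^[i] ⟨y, hy, hy1, hy2⟩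
  have hF : ∀ i, F (i + 1) = g (F i) := fun i => Function.iterate_succ_apply' _ _ _
  let G : ℕ → ℕ := fun i => ∏ t ∈ Finset.range i, c (F t)
  have hG : ∀ i, G (i + 1) = G i * c (F i) := fun i => Finset.prod_range_succ _ _
  have hGpos : ∀ i, 0 < G i := fun i =>
    Finset.prod_pos (fun t _ => lt_of_lt_of_le (by norm_num) (hc2 (F t)))
  have hGm : StrictMono G := strictMono_nat_of_lt_succ (fun i => by
    rw [hG]
    nlinarith [hGpos i, hc2 (F i)])
  have hGle : ∀ i, G i ≤ (k + 1) ^ i := by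
    intro i
    induction i with
    | zero => simp [G]
    | succ i ih =>
      rw [hG, pow_succ]
      exact Nat.mul_le_mul ih (hck _)
  have hGd : ∀ i, d ∣ (F i).1 - G i * y := by
    intro i
    induction i with
    | zero => simp [G, F]
    | succ i ih =>
      rw [hG, hF]
      have e := dvd_add (hdvd (F i)) (Dvd.dvd.mul_left ih (c (F i) : ℤ))
      have e' : (g (F i)).1 - ((G i * c (F i) : ℕ) : ℤ) * y =
          (g (F i)).1 - c (F i) * (F i).1 + c (F i) * ((F i).1 - G i * y) := by
        push_cast
        ring
      rw [e']
      exact e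
  obtain ⟨i, hi, j, hj, hij, hfl⟩ := Finset.exists_ne_map_eq_of_card_lt_of_maps_to
    (s := Finset.range (M + 1)) (t := Finset.Icc (-ℓ * P) (m * P))
    (f := fun i => (P * (F i).1) / d)
    (by
      simp only [Int.card_Icc, Finset.card_range]
      have : m * P + 1 - -ℓ * P ≤ M := by linarith
      omega)
    (by
      intro i _
      have h1 := (F i).2.2.1
      have h2 := (F i).2.2.2
      have hP : (0 : ℤ) ≤ P := by positivity
      simp only [Finset.coe_Icc, Set.mem_Icc]
      constructor
      · rw [Int.le_ediv_iff_mul_le (by linarith)]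
        nlinarith
      · refine Int.ediv_le_of_le_mul (by linarith) ?_
        nlinarith)
  wlog hlt : i < j generalizing i j
  · exact this j hj i hi hij.symm hfl.symm (lt_of_le_of_ne (not_lt.mp hlt) hij.symm)
  have aux : ∀ u v : S, u.1 < v.1 → (P * u.1) / d < (P * v.1) / d := by
    intro u v huv
    have := hsep u.1 u.2.1 v.1 v.2.1 u.2.2.1 huv v.2.2.2
    have e : (P * u.1) / d + 1 ≤ (P * v.1) / d := by
      have e0 : (P * u.1) / d + 1 = (P * u.1 + d) / d := by
        rw [Int.add_ediv_of_dvd_right (dvd_refl d), Int.ediv_self (by linarith)]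
      rw [e0]
      apply Int.ediv_le_ediv (by linarith)
      linarith
    linarith
  have hFF : (F i).1 = (F j).1 := by
    rcases lt_trichotomy (F i).1 (F j).1 with hh | hh | hh
    · exact absurd hfl (aux _ _ hh).ne
    · exact hh
    · exact absurd hfl (aux _ _ hh).ne'
  have hGij := hGm hlt
  refine ⟨G j - G i, by omega, ?_, ?_⟩
  · refine (Nat.sub_le _ _).trans ((hGle j).trans (Nat.pow_le_pow_right (by omega) ?_))
    simp at hj
    omega
  · have e := dvd_sub (hGd i) (hGd j)
    rw [hFF] at e
    have e' : ((G j - G i : ℕ) : ℤ) * y = (F j).1 - G i * y - ((F j).1 - G j * y) := by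
      rw [Nat.cast_sub hGij.le]
      ring
    rw [e']
    exact e

/-- For every positive integer k there is N₀ = N₀(k) such that for every
integer B ≥ N₀ there is D₀ = D₀(B,k) with: for every colouring of ℤ with no (2,k)-AP
and every d ≥ 1 with [0, d] a gap, there exist ℓ, m ≥ B such that d[−ℓ, m] is an
extendable table and every red integer in [−ℓd, md] equals r·d for some rational r with
denominator at most D₀. -/
theorem statement12 (k : ℕ) (hk : 0 < k) :
    ∃ N₀ : ℕ, ∀ B : ℕ, N₀ ≤ B → ∃ D₀ : ℕ,
      ∀ R : Set ℤ, ¬ HasAPZ R 2 k →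
        ∀ d : ℤ, 1 ≤ d → IsGap R 0 d →
          ∃ ℓ m : ℤ, (B : ℤ) ≤ ℓ ∧ (B : ℤ) ≤ m ∧ ExtendableTable R k d ℓ m ∧
            ∀ x ∈ Set.Icc (-ℓ * d) (m * d), x ∈ R →
              ∃ r : ℚ, (x : ℚ) = r * (d : ℚ) ∧ r.den ≤ D₀ := by
  refine ⟨(k + 1) * sepC k (k + 1), fun B hB => ?_⟩
  let Q := (k + 1) * B
  let P := sepC k Q
  refine ⟨(k + 1) ^ (2 * Q * P + 1), ?_⟩
  intro R hR d hd hgap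
  have h := goodSet_of_noAP hR
  obtain ⟨-, h0, h1, hblue⟩ := hgap
  have hSpos : ∀ q, 0 < sepC k q := fun q => by unfold sepC; positivity
  have hB1 : 1 ≤ B := le_trans (Nat.mul_pos (Nat.succ_pos k) (hSpos _)) hB
  have hB' : ((k + 1) * sepC k (k + 1) : ℤ) ≤ B := by exact_mod_cast hB
  obtain ⟨m, hmR, hm1, hm2⟩ := (h.affine 0 d (by linarith)).exists_next 0 (by simpa using h0) B B 1
    (by simpa using h1) one_pos (by simpa using hB1) (by linarith)
  obtain ⟨l, hlR, hl1, hl2⟩ := (h.affine d (-d) (by linarith)).exists_next 0 (by simpa using h1)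
    B B 1 (by simpa using h0) one_pos (by simpa using hB1) (by linarith)
  have hmR' : m * d ∈ R := by simpa using hmR
  have hlR' : -(l - 1) * d ∈ R := by
    have : d + l * -d ∈ R := hlR
    convert this using 1
    ring
  have hQ : (Q : ℤ) = (k + 1) * B := by simp [Q]
  have hBl : (B : ℤ) ≤ l - 1 := by linarith
  have hBm : (B : ℤ) ≤ m := by linarith
  have ht : ∀ ℓ' m' : ℤ, (B : ℤ) ≤ ℓ' → (B : ℤ) ≤ m' → -ℓ' * d ∈ R → m' * d ∈ R →
      IsTable R k d ℓ' m' := fun ℓ' m' ha hb hc he =>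
    h.table d hd h0 h1 ℓ' m' (hB'.trans ha) (hB'.trans hb) hc he
  refine ⟨l - 1, m, hBl, hBm, ⟨ht _ _ hBl hBm hlR' hmR', fun ℓ' m' ha hb hc he =>
    ht ℓ' m' (hBl.trans ha) (hBm.trans hb) hc he⟩, ?_⟩
  rintro y ⟨hy1, hy2⟩ hy
  have hP1 : (1 : ℤ) ≤ P := by exact_mod_cast hSpos Q
  obtain ⟨q, hq0, hq1, hq2⟩ := h.denominators hk d hd (l - 1) m (ht _ _ hBl hBm hlR' hmR') P
    (2 * Q * P + 1) (by
      push_cast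
      have : (m + (l - 1)) * (P : ℤ) ≤ 2 * Q * P :=
        mul_le_mul_of_nonneg_right (by linarith) (by linarith)
      linarith) (by
      intro u hu v hv hul huv hvm
      by_cases hv0 : v ≤ 0
      · have := h.sep' 0 d Q hblue u v hu hv huv (Or.inl ⟨hv0, by nlinarith⟩)
        linarith
      by_cases hud : d ≤ u
      · have := h.sep' 0 d Q hblue u v hu hv huv (Or.inr ⟨hud, by nlinarith⟩)
        linarith
      have hv1 : d ≤ v := by
        by_contra hc
        exact hblue v (by linarith) (by linarith) hv
      have hu1 : u ≤ 0 := by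
        by_contra hc
        exact hblue u (by linarith) (by linarith) hu
      nlinarith) y hy hy1 hy2
  refine ⟨(y : ℚ) / d, ?_, ?_⟩
  · have : (d : ℚ) ≠ 0 := by exact_mod_cast (show d ≠ 0 by linarith)
    field_simp
  · obtain ⟨w, hw⟩ := hq2
    have hd0 : (d : ℚ) ≠ 0 := by exact_mod_cast (show d ≠ 0 by linarith)
    have hq0' : (q : ℚ) ≠ 0 := by exact_mod_cast hq0.ne'
    have e : (y : ℚ) / d = (w : ℚ) / ((q : ℤ) : ℚ) := by
      rw [div_eq_div_iff hd0 (by exact_mod_cast hq0')]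
      have : (q : ℚ) * y = d * w := by exact_mod_cast hw
      push_cast
      linarith
    have e2 := Rat.den_dvd w q
    rw [← Rat.intCast_div_eq_divInt, ← e] at e2
    exact (Nat.le_of_dvd hq0 (by exact_mod_cast e2)).trans hq1
end

section
/- For every positive integer k there exists p₀ = p₀(k) such that the following holds: for every red–blue colouring of ℤ containing no (2,k)-AP, if [0, d] is a gap and d ≥ p₀ is prime, then every red integer is a multiple of d. -/
def NoAP (k : ℕ) (R : Set ℤ) : Prop :=
  ∀ x ∈ R, ∀ y ∈ R, x ≠ y → ∃ s : ℤ, 2 ≤ s ∧ s ≤ k + 1 ∧ x + s * (y - x) ∈ R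

lemma noAP_of (k : ℕ) (R : Set ℤ) (h : ¬ HasAPZ R 2 k) : NoAP k R := by
  intro x hx y hy hxy
  by_contra! hc
  apply h
  refine ⟨x, y - x, sub_ne_zero.mpr hxy.symm, ?_, ?_⟩
  · intro i hi
    interval_cases i
    · simpa using hx
    · simpa using hy
  · intro i hi hi2
    exact hc i (by exact_mod_cast hi) (by omega)

lemma NoAP.reflect {k : ℕ} {R : Set ℤ} (h : NoAP k R) (c : ℤ) :
    NoAP k {x | c - x ∈ R} := by
  intro x hx y hy hxy
  obtain ⟨s, h1, h2, h3⟩ := h _ hx _ hy (by omega)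
  refine ⟨s, h1, h2, ?_⟩
  have : c - (x + s * (y - x)) = c - x + s * (c - y - (c - x)) := by ring
  simpa [this] using h3

lemma gap_reflect {R : Set ℤ} {u v : ℤ} (h : IsGap R u v) (c : ℤ) :
    IsGap {x | c - x ∈ R} (c - v) (c - u) := by
  obtain ⟨h1, h2, h3, h4⟩ := h
  refine ⟨by omega, by simpa using h3, by simpa using h2, ?_⟩
  intro n hn1 hn2
  exact h4 (c - n) (by omega) (by omega)

lemma ratio {k : ℕ} {R : Set ℤ} (h : NoAP k R) {u v y : ℤ} (hg : IsGap R u v)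
    (hy : y ∈ R) (hyu : y < u) : v - u ≤ k * (u - y) := by
  obtain ⟨s, h1, h2, h3⟩ := h y hy u hg.2.1 hyu.ne
  by_contra! hc
  refine hg.2.2.2 _ ?_ ?_ h3
  · nlinarith
  · nlinarith

lemma cluster {k : ℕ} {R : Set ℤ} (h : NoAP k R) {a b : ℤ} (ha : a ∈ R) (hb : b ∈ R)
    (hab : a < b) (m : ℕ) : ∃ T : Finset ℤ, ∃ e : ℤ, T.card = m + 1 ∧ (∀ y ∈ T, y ∈ R) ∧
      0 < e ∧ e ≤ (k + 1) ^ m * (b - a) ∧ b - e ∈ R ∧ ∀ y ∈ T, b - e ≤ y ∧ y < b := by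
  induction m with
  | zero => exact ⟨{a}, b - a, by simp, by simpa using ha, by omega, by simp, by simpa using ha,
      by simpa using hab⟩
  | succ m ih =>
    obtain ⟨T, e, h1, h2, h3, h4, h5, h6⟩ := ih
    obtain ⟨s, s1, s2, s3⟩ := h b hb (b - e) h5 (by omega)
    have e1 : b + s * (b - e - b) = b - s * e := by ring
    rw [e1] at s3
    have hlt : b - s * e < b - e := by nlinarith
    refine ⟨insert (b - s * e) T, s * e, ?_, ?_, by nlinarith, ?_, s3, ?_⟩
    · rw [Finset.card_insert_of_notMem, h1]
      intro hm
      have := (h6 _ hm).1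
      omega
    · intro y hy
      rcases Finset.mem_insert.1 hy with rfl | hy
      · exact s3
      · exact h2 _ hy
    · calc s * e ≤ (k + 1) * ((k + 1) ^ m * (b - a)) := by gcongr
        _ = _ := by ring
    · intro y hy
      rcases Finset.mem_insert.1 hy with rfl | hy
      · constructor <;> nlinarith
      · have := h6 _ hy
        constructor <;> linarith [this.1, this.2]

lemma push {k : ℕ} (hk : 0 < k) {R : Set ℤ} (h : NoAP k R) {u v : ℤ} (hg : IsGap R u v)
    (n : ℕ) : ∀ (T : Finset ℤ) (q ε : ℤ), 2 * k ^ n ≤ T.card → (∀ y ∈ T, y ∈ R) → q ∈ T →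
      (∀ y ∈ T, q ≤ y ∧ y ≤ q + ε ∧ y ≤ u) →
      (k : ℤ) ^ 2 * (k + 1) ^ 2 * ε * k ^ n ≤ v - u →
      (v - u) * ((k + 1 : ℤ) ^ 2) ^ n ≤ k * (u - q) * ((k + 1 : ℤ) ^ 2 - 1) ^ n := by
  have hk' : (1 : ℤ) ≤ k := by exact_mod_cast hk
  induction n with
  | zero =>
    intro T q ε hT hR hq hb hε
    obtain ⟨y, hy, hyq⟩ := Finset.exists_mem_ne (by simp at hT; omega : 1 < T.card) q
    have := hb y hy
    have := ratio h hg (hR q hq) (by omega)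
    simpa using this
  | succ n ih =>
    intro T q ε hT hR hq hb hε
    have hkn : 1 ≤ k ^ n := Nat.one_le_pow _ _ hk
    have hT2 : 1 < T.card := by
      have : 1 ≤ k ^ (n + 1) := Nat.one_le_pow _ _ hk
      omega
    obtain ⟨y₁, hy₁, hyq⟩ := Finset.exists_mem_ne hT2 q
    have hb1 := hb y₁ hy₁
    have hqu : q < u := by omega
    have hε0 : 0 < ε := by omega
    have hrat := ratio h hg (hR q hq) hqu
    have hK : (k : ℤ) ^ 2 * (k + 1) ^ 2 * ε ≤ v - u := by
      have : (1 : ℤ) ≤ k ^ (n + 1) := one_le_pow₀ hk'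
      have h0 : 0 ≤ (k : ℤ) ^ 2 * (k + 1) ^ 2 * ε := by positivity
      nlinarith
    have hKD : (k : ℤ) * (k + 1) ^ 2 * ε ≤ u - q := by
      have : (k : ℤ) * (k * (k + 1) ^ 2 * ε) ≤ k * (u - q) := by
        calc _ = (k : ℤ) ^ 2 * (k + 1) ^ 2 * ε := by ring
          _ ≤ _ := hK.trans hrat
      exact le_of_mul_le_mul_left this (by omega)
    -- choose maximal e
    have hex : ∃ e : ℤ, (0 < e ∧ q + e ∈ R ∧ (k + 1) * e ≤ u - q) ∧
        ∀ z : ℤ, (0 < z ∧ q + z ∈ R ∧ (k + 1) * z ≤ u - q) → z ≤ e := by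
      apply Int.exists_greatest_of_bdd
      · refine ⟨u - q, ?_⟩
        rintro z ⟨z1, z2, z3⟩
        nlinarith
      · refine ⟨y₁ - q, by omega, by simpa using hR _ hy₁, ?_⟩
        have h1 : ((k : ℤ) + 1) * (y₁ - q) ≤ (k + 1) * ε := by gcongr; omega
        have h2 : ((k : ℤ) + 1) * ε ≤ k * (k + 1) ^ 2 * ε := by
          gcongr
          nlinarith
        linarith
    obtain ⟨e, ⟨e0, eR, eD⟩, emax⟩ := hex
    have eK : u - q < (k + 1) ^ 2 * e := by
      obtain ⟨s, s1, s2, s3⟩ := h q (hR q hq) _ eR (by omega)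
      have e1 : q + s * (q + e - q) = q + s * e := by ring
      rw [e1] at s3
      by_contra! hc
      have := emax (s * e) ⟨by positivity, s3, by
        calc ((k : ℤ) + 1) * (s * e) ≤ (k + 1) * ((k + 1) * e) := by gcongr
          _ = (k + 1) ^ 2 * e := by ring
          _ ≤ _ := hc⟩
      nlinarith
    -- pigeonhole
    have hq' : ∀ y ∈ T, ∃ s : ℤ, 2 ≤ s ∧ s ≤ k + 1 ∧ y + s * (q + e - y) ∈ R := by
      intro y hy
      refine h y (hR y hy) _ eR ?_
      have := hb y hy
      have : ε < e := by
        by_contra! hc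
        have : (k + 1) ^ 2 * e ≤ (k : ℤ) * (k + 1) ^ 2 * ε := by
          calc ((k : ℤ) + 1) ^ 2 * e ≤ (k + 1) ^ 2 * ε := by gcongr
            _ ≤ k * ((k + 1) ^ 2 * ε) := le_mul_of_one_le_left (by positivity) hk'
            _ = _ := by ring
        linarith
      omega
    choose! f f1 f2 f3 using hq'
    obtain ⟨s, hs, hcard⟩ := Finset.exists_le_card_fiber_of_mul_le_card_of_maps_to
      (s := T) (t := Finset.Icc (2 : ℤ) (k + 1)) (f := f) (n := 2 * k ^ n)
      (fun y hy => Finset.mem_Icc.2 ⟨f1 y hy, f2 y hy⟩) ⟨2, by simp; omega⟩ (by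
        have : (Finset.Icc (2 : ℤ) (k + 1)).card = k := by simp; omega
        rw [this]
        calc k * (2 * k ^ n) = 2 * k ^ (n + 1) := by ring
          _ ≤ _ := hT)
    rw [Finset.mem_Icc] at hs
    obtain ⟨s1, s2⟩ := hs
    set T₁ := T.filter (fun y => f y = s) with hT₁
    set T' := T₁.image (fun y => y + s * (q + e - y)) with hT'
    have hc' : T'.card = T₁.card := by
      apply Finset.card_image_of_injective
      intro y z hyz
      have h1 : (s - 1) * (y - z) = 0 := by simp only at hyz; linarith
      rcases mul_eq_zero.1 h1 with h1 | h1 <;> omega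
    have hne : T'.Nonempty := by
      rw [← Finset.card_pos, hc']
      omega
    have hbd : ∀ z ∈ T', q + s * e - (s - 1) * ε ≤ z ∧ z ≤ q + s * e ∧ z ∈ R := by
      intro z hz
      obtain ⟨y, hy, rfl⟩ := Finset.mem_image.1 hz
      rw [hT₁, Finset.mem_filter] at hy
      have h1 := hb y hy.1
      have h2 := f3 y hy.1
      rw [hy.2] at h2
      refine ⟨?_, ?_, h2⟩
      · nlinarith
      · nlinarith
    have hq'mem := T'.min'_mem hne
    set q' := T'.min' hne with hq'
    have hqb := hbd q' hq'mem
    have key := ih T' q' (k * ε) (by rw [hc']; exact hcard) (fun y hy => (hbd y hy).2.2) hq'mem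
      (by
        intro y hy
        have := hbd y hy
        refine ⟨T'.min'_le y hy, ?_, ?_⟩
        · have : (s - 1) * ε ≤ k * ε := by gcongr; omega
          linarith
        · have : s * e ≤ (k + 1) * e := by gcongr
          linarith)
      (by
        calc _ = (k : ℤ) ^ 2 * (k + 1) ^ 2 * ε * k ^ (n + 1) := by ring
          _ ≤ _ := hε)
    have hD' : ((k : ℤ) + 1) ^ 2 * (u - q') ≤ ((k + 1) ^ 2 - 1) * (u - q) := by
      have h1 : (s - 1) * ε ≤ k * ε := by gcongr; omega
      have h2 : 2 * e ≤ s * e := by gcongr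
      have h3 : u - q' ≤ u - q - 2 * e + k * ε := by linarith
      have h4 : ((k : ℤ) + 1) ^ 2 * (u - q') ≤ (k + 1) ^ 2 * (u - q - 2 * e + k * ε) := by gcongr
      nlinarith
    have hp : (0 : ℤ) ≤ ((k : ℤ) + 1) ^ 2 - 1 := by nlinarith
    calc (v - u) * (((k : ℤ) + 1) ^ 2) ^ (n + 1)
        = ((v - u) * (((k : ℤ) + 1) ^ 2) ^ n) * (k + 1) ^ 2 := by ring
      _ ≤ (k * (u - q') * (((k : ℤ) + 1) ^ 2 - 1) ^ n) * (k + 1) ^ 2 := by gcongr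
      _ = k * (((k : ℤ) + 1) ^ 2 * (u - q')) * (((k : ℤ) + 1) ^ 2 - 1) ^ n := by ring
      _ ≤ k * (((k + 1) ^ 2 - 1) * (u - q)) * (((k : ℤ) + 1) ^ 2 - 1) ^ n := by gcongr
      _ = _ := by ring

lemma exists_pow (K B : ℤ) (hK : 2 ≤ K) : ∃ n : ℕ, B * (K - 1) ^ n < K ^ n := by
  have hKr : (2 : ℝ) ≤ K := by exact_mod_cast hK
  obtain ⟨n, hn⟩ := pow_unbounded_of_one_lt (B : ℝ)
    (show (1 : ℝ) < (K : ℝ) / (K - 1) by rw [lt_div_iff₀ (by linarith)]; linarith)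
  refine ⟨n, ?_⟩
  rw [div_pow, lt_div_iff₀ (pow_pos (by linarith) _)] at hn
  exact_mod_cast hn

lemma far (k : ℕ) (hk : 0 < k) (C : ℤ) (hC : 0 ≤ C) : ∃ E : ℤ, 1 ≤ E ∧ ∀ R : Set ℤ, NoAP k R →
    ∀ u v a b : ℤ, IsGap R u v → a ∈ R → b ∈ R → a < b → b ≤ u → u - b ≤ C * (v - u) →
      v - u ≤ E * (b - a) := by
  have hk' : (1 : ℤ) ≤ k := by exact_mod_cast hk
  obtain ⟨n, hn⟩ := exists_pow (((k : ℤ) + 1) ^ 2) (k * (C + 1)) (by nlinarith)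
  have hE1 : (1 : ℤ) ≤ (k : ℤ) ^ 2 * (k + 1) ^ 2 * k ^ n :=
    one_le_mul_of_one_le_of_one_le
      (one_le_mul_of_one_le_of_one_le (one_le_pow₀ hk') (one_le_pow₀ (by omega))) (one_le_pow₀ hk')
  refine ⟨(k : ℤ) ^ 2 * (k + 1) ^ 2 * k ^ n * (k + 1) ^ (2 * k ^ n), ?_, ?_⟩
  · exact one_le_mul_of_one_le_of_one_le hE1 (one_le_pow₀ (by omega))
  intro R h u v a b hg ha hb hab hbu hdist
  by_contra! hlt
  obtain ⟨T, e, h1, h2, h3, h4, h5, h6⟩ := cluster h ha hb hab (2 * k ^ n)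
  have hne : T.Nonempty := by rw [← Finset.card_pos]; omega
  have hmem := T.min'_mem hne
  have hmq := h6 _ hmem
  have hE : (k : ℤ) ^ 2 * (k + 1) ^ 2 * k ^ n * e ≤ v - u := by
    calc _ ≤ (k : ℤ) ^ 2 * (k + 1) ^ 2 * k ^ n * ((k + 1) ^ (2 * k ^ n) * (b - a)) := by gcongr
      _ = (k : ℤ) ^ 2 * (k + 1) ^ 2 * k ^ n * (k + 1) ^ (2 * k ^ n) * (b - a) := by ring
      _ ≤ _ := hlt.le
  have key := push hk h hg n T (T.min' hne) e (by omega) h2 hmem (by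
      intro y hy
      have := h6 y hy
      refine ⟨T.min'_le y hy, by omega, by omega⟩) (by
      calc _ = (k : ℤ) ^ 2 * (k + 1) ^ 2 * k ^ n * e := by ring
        _ ≤ _ := hE)
  have heL : e ≤ v - u := by nlinarith
  have hD : u - T.min' hne ≤ (C + 1) * (v - u) := by linarith
  have hp : (0 : ℤ) ≤ ((k : ℤ) + 1) ^ 2 - 1 := by nlinarith
  have hL : 0 < v - u := by have := hg.1; omega
  have : (v - u) * (((k : ℤ) + 1) ^ 2) ^ n < (v - u) * (((k : ℤ) + 1) ^ 2) ^ n := by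
    calc _ ≤ _ := key
      _ ≤ k * ((C + 1) * (v - u)) * (((k : ℤ) + 1) ^ 2 - 1) ^ n := by gcongr
      _ = (v - u) * (k * (C + 1) * (((k : ℤ) + 1) ^ 2 - 1) ^ n) := by ring
      _ < _ := by gcongr
  exact lt_irrefl _ this

/-- Equation for reds to the right of the gap. -/
lemma eqn {k : ℕ} {R : Set ℤ} (h : NoAP k R) {E d : ℤ} (hg : IsGap R 0 d) (hE : 1 ≤ E)
    (hfar : ∀ u v a b : ℤ, IsGap R u v → a ∈ R → b ∈ R → a < b → b ≤ u →
      u - b ≤ k * (v - u) → v - u ≤ E * (b - a)) (w : ℤ) (hw : w ∈ R) (hdw : d < w) :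
    ∃ w' l s : ℤ, w' ∈ R ∧ l ∈ R ∧ 1 ≤ s ∧ s ≤ k ∧ d ≤ w' ∧ w' < w ∧
      (∀ x ∈ R, x < w → x ≤ w') ∧ l = (s + 1) * w' - s * w ∧ -(k * E * d) ≤ l := by
  obtain ⟨w', ⟨h1, h2⟩, hmax⟩ : ∃ w' : ℤ, (w' ∈ R ∧ w' < w) ∧ ∀ z : ℤ, (z ∈ R ∧ z < w) → z ≤ w' :=
    Int.exists_greatest_of_bdd ⟨w, fun z hz => hz.2.le⟩ ⟨d, hg.2.2.1, hdw⟩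
  have hdw' : d ≤ w' := hmax d ⟨hg.2.2.1, hdw⟩
  have hgap : IsGap R w' w := ⟨h2, h1, hw, fun n hn hn2 hn3 => by
    have := hmax n ⟨hn3, hn2⟩
    omega⟩
  obtain ⟨s, s1, s2, s3⟩ := h w hw w' h1 (by omega)
  have hd := hg.1
  refine ⟨w', w + s * (w' - w), s - 1, h1, s3, by omega, by omega, hdw', h2,
    fun x hx hxw => hmax x ⟨hx, hxw⟩, by ring, ?_⟩
  have hs : (s - 1) * (w - w') ≤ k * (w - w') := by gcongr; omega
  have hp : 0 ≤ k * E * d := by positivity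
  by_cases hc : w' - d ≤ k * (w - w')
  · have h3 := hfar w' w 0 d hgap hg.2.1 hg.2.2.1 hd hdw' hc
    have h4 : k * (w - w') ≤ k * (E * (d - 0)) := by gcongr
    nlinarith
  · push Not at hc
    nlinarith

lemma side {ι : Type*} [LinearOrder ι] [Finite ι] (z : ι → ℚ) (hz : Monotone z) (o e : ι)
    (hoe : z o < z e) (hcov : ∀ i, i ≤ o ∨ e ≤ i) (p l : ι → ι) (s : ι → ℚ)
    (heq : ∀ i, e < i → e ≤ p i ∧ p i < i ∧ (∀ j, j < i → j ≤ p i) ∧ l i < p i ∧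
      (s i + 1) * z (p i) - s i * z i = z (l i)) : ∀ i, e < i → z (p i) < z i := by
  intro i
  induction i using WellFoundedLT.induction with
  | ind i ih =>
    intro hi
    obtain ⟨h1, h2, h3, h4, h5⟩ := heq i hi
    refine lt_of_le_of_ne (hz h2.le) fun hne => ?_
    rw [hne] at h5
    have h6 : z (l i) = z (p i) := by rw [hne]; linarith
    rcases h1.eq_or_lt with h1 | h1
    · rcases hcov (l i) with h7 | h7
      · have := hz h7
        rw [h6, ← h1] at this
        linarith
      · rw [h1] at h7
        exact absurd h4 (not_lt.2 h7)
    · have h8 := ih _ h2 h1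
      have h9 := hz ((heq _ h1).2.2.1 _ h4)
      linarith

lemma ker_aux {ι : Type*} [LinearOrder ι] [Fintype ι] (x y : ι → ℚ) (hx : StrictMono x) (o e : ι)
    (hoe : o < e) (hcov : ∀ i, i ≤ o ∨ e ≤ i) (p l : ι → ι) (s : ι → ℚ)
    (hR : ∀ i, e < i → e ≤ p i ∧ p i < i ∧ (∀ j, j < i → j ≤ p i) ∧ l i < p i)
    (hL : ∀ i, i < o → p i ≤ o ∧ i < p i ∧ (∀ j, i < j → p i ≤ j) ∧ p i < l i)
    (hex : ∀ i, i < o ∨ e < i → (s i + 1) * x (p i) - s i * x i = x (l i))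
    (hey : ∀ i, i < o ∨ e < i → (s i + 1) * y (p i) - s i * y i = y (l i))
    (hyo : y o = 0) (hye : y e = 0) : ∀ a b, a < b → y b ≤ y a := by
  classical
  obtain ⟨⟨a, b⟩, hab, hmax⟩ := Finset.exists_max_image
    (Finset.univ.filter (fun q : ι × ι => q.1 < q.2))
    (fun q => (y q.2 - y q.1) / (x q.2 - x q.1)) ⟨(o, e), by simpa using hoe⟩
  simp only [Finset.mem_filter, Finset.mem_univ, true_and, Prod.forall] at hab hmax
  set ρ := (y b - y a) / (x b - x a) with hρ
  have hmul : ∀ c c', c < c' → y c' - y c ≤ ρ * (x c' - x c) := by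
    intro c c' h
    have := hmax c c' h
    rwa [div_le_iff₀ (sub_pos.2 (hx h))] at this
  by_cases hpos : 0 < ρ
  · exfalso
    set z : ι → ℚ := fun i => ρ * x i - y i with hz
    have hzm : Monotone z := by
      intro c c' h
      rcases h.eq_or_lt with rfl | h
      · exact le_rfl
      · have := hmul c c' h
        simp only [hz]
        linarith
    have hzoe : z o < z e := by
      simp only [hz, hyo, hye]
      have := mul_lt_mul_of_pos_left (hx hoe) hpos
      linarith
    have hez : ∀ i, i < o ∨ e < i → (s i + 1) * z (p i) - s i * z i = z (l i) := by
      intro i hi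
      have h1 := hex i hi
      have h2 := hey i hi
      simp only [hz]
      rw [← h1, ← h2]
      ring
    have r1 := side z hzm o e hzoe hcov p l s (fun i hi =>
      ⟨(hR i hi).1, (hR i hi).2.1, (hR i hi).2.2.1, (hR i hi).2.2.2, hez i (Or.inr hi)⟩)
    have r2 := side (ι := ιᵒᵈ) (fun i => - z (OrderDual.ofDual i))
      (fun c c' h => neg_le_neg (hzm h)) (OrderDual.toDual e) (OrderDual.toDual o)
      (neg_lt_neg hzoe) (fun i => (hcov (OrderDual.ofDual i)).symm)
      (fun i => OrderDual.toDual (p (OrderDual.ofDual i)))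
      (fun i => OrderDual.toDual (l (OrderDual.ofDual i))) (fun i => s (OrderDual.ofDual i))
      (fun i hi => ⟨(hL _ hi).1, (hL _ hi).2.1, fun j hj => (hL _ hi).2.2.1 _ hj,
        (hL _ hi).2.2.2, by
          have := hez (OrderDual.ofDual i) (Or.inl hi)
          simp only [OrderDual.ofDual_toDual]
          linarith⟩)
    have hzab : z a = z b := by
      have : x b - x a ≠ 0 := (sub_pos.2 (hx hab)).ne'
      have h1 : ρ * (x b - x a) = y b - y a := by rw [hρ]; field_simp
      simp only [hz]
      linarith
    rcases hcov b with hb | hb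
    · -- a < b ≤ o
      have ha : a < o := lt_of_lt_of_le hab hb
      have h1 : -z (p a) < -z a := r2 (OrderDual.toDual a) ha
      have h2 := hzm ((hL a ha).2.2.1 b hab)
      linarith
    · rcases hb.eq_or_lt with rfl | hb
      · rcases hcov a with ha | ha
        · have := hzm ha
          linarith
        · exact absurd hab (not_lt.2 ha)
      · have h1 := r1 b hb
        have h2 := hzm ((hR b hb).2.2.1 a hab)
        linarith
  · intro c c' h
    have h1 := hmul c c' h
    have h2 := sub_pos.2 (hx h)
    nlinarith

lemma ker {ι : Type*} [LinearOrder ι] [Fintype ι] (x y : ι → ℚ) (hx : StrictMono x) (o e : ι)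
    (hoe : o < e) (hcov : ∀ i, i ≤ o ∨ e ≤ i) (p l : ι → ι) (s : ι → ℚ)
    (hR : ∀ i, e < i → e ≤ p i ∧ p i < i ∧ (∀ j, j < i → j ≤ p i) ∧ l i < p i)
    (hL : ∀ i, i < o → p i ≤ o ∧ i < p i ∧ (∀ j, i < j → p i ≤ j) ∧ p i < l i)
    (hex : ∀ i, i < o ∨ e < i → (s i + 1) * x (p i) - s i * x i = x (l i))
    (hey : ∀ i, i < o ∨ e < i → (s i + 1) * y (p i) - s i * y i = y (l i))
    (hyo : y o = 0) (hye : y e = 0) : ∀ a, y a = 0 := by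
  have h1 := ker_aux x y hx o e hoe hcov p l s hR hL hex hey hyo hye
  have h2 := ker_aux x (fun i => - y i) hx o e hoe hcov p l s hR hL hex
    (fun i hi => by rw [← hey i hi]; ring) (by simp [hyo]) (by simp [hye])
  intro a
  rcases lt_trichotomy a o with h | h | h
  · have := h1 a o h
    have := h2 a o h
    linarith
  · rw [h, hyo]
  · have := h1 o a h
    have := h2 o a h
    linarith

lemma alg {ι : Type*} [LinearOrder ι] [Fintype ι] (x : ι → ℤ) (hx : StrictMono x) (o e : ι)
    (hoe : o < e) (hcov : ∀ i, i ≤ o ∨ e ≤ i) (p l : ι → ι) (s : ι → ℤ) (k : ℕ)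
    (hs : ∀ i, 0 ≤ s i ∧ s i ≤ k)
    (hR : ∀ i, e < i → e ≤ p i ∧ p i < i ∧ (∀ j, j < i → j ≤ p i) ∧ l i < p i)
    (hL : ∀ i, i < o → p i ≤ o ∧ i < p i ∧ (∀ j, i < j → p i ≤ j) ∧ p i < l i)
    (hex : ∀ i, i < o ∨ e < i → (s i + 1) * x (p i) - s i * x i = x (l i))
    (n : ℕ) (hn : Fintype.card ι ≤ n) (d : ℤ) (hd : Prime d)
    (hbig : (n.factorial : ℤ) * (2 * k + 2) ^ n < d)
    (hxo : d ∣ x o) (hxe : d ∣ x e) : ∀ a, d ∣ x a := by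
  classical
  let M : Matrix ι ι ℤ := fun i j =>
    if i < o ∨ e < i then (s i + 1) * (if p i = j then 1 else 0) - s i * (if i = j then 1 else 0)
      - (if l i = j then 1 else 0)
    else if i = j then 1 else 0
  have hM1 : ∀ (y : ι → ℤ) i, (i < o ∨ e < i) →
      M.mulVec y i = (s i + 1) * y (p i) - s i * y i - y (l i) := by
    intro y i hi
    simp [Matrix.mulVec, dotProduct, M, hi, sub_mul, Finset.sum_sub_distrib]
  have hM2 : ∀ (y : ι → ℤ) i, ¬ (i < o ∨ e < i) → M.mulVec y i = y i := by
    intro y i hi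
    simp [Matrix.mulVec, dotProduct, M, hi]
  have ho : ¬ (o < o ∨ e < o) := by simp [hoe.le]
  have he : ¬ (e < o ∨ e < e) := by simp [hoe.le]
  have hdet : M.det ≠ 0 := by
    intro h0
    obtain ⟨y, hy0, hy⟩ := Matrix.exists_mulVec_eq_zero_iff.2 h0
    apply hy0
    funext a
    have := ker (fun i => (x i : ℚ)) (fun i => (y i : ℚ)) (fun a b h => Int.cast_lt.2 (hx h))
      o e hoe hcov p l (fun i => (s i : ℚ)) hR hL (fun i hi => by exact_mod_cast hex i hi)
      (fun i hi => by
        have h1 := hM1 y i hi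
        rw [hy] at h1
        simp only [Pi.zero_apply] at h1
        have : (s i + 1) * y (p i) - s i * y i = y (l i) := by linarith
        exact_mod_cast this)
      (by
        have h1 := hM2 y o ho
        rw [hy] at h1
        simpa using h1.symm)
      (by
        have h1 := hM2 y e he
        rw [hy] at h1
        simpa using h1.symm) a
    exact_mod_cast this
  have hle : |M.det| ≤ (Fintype.card ι).factorial • ((2 * k + 2 : ℤ)) ^ (Fintype.card ι) := by
    refine Matrix.det_le (A := M) (abv := AbsoluteValue.abs) (x := (2 * k + 2 : ℤ)) ?_
    intro i j
    have := hs i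
    simp only [AbsoluteValue.abs_apply, M, abs_le]
    split_ifs <;> constructor <;> omega
  have hlt : |M.det| < d := by
    refine lt_of_le_of_lt (hle.trans ?_) hbig
    rw [nsmul_eq_mul]
    have : ((Fintype.card ι).factorial : ℤ) ≤ n.factorial := by
      exact_mod_cast Nat.factorial_le hn
    gcongr
    linarith
  have hndvd : ¬ d ∣ M.det := by
    intro h
    have := Int.le_of_dvd (abs_pos.2 hdet) ((dvd_abs _ _).2 h)
    omega
  have hMx : ∀ i, d ∣ M.mulVec x i := by
    intro i
    by_cases hi : i < o ∨ e < i
    · rw [hM1 x i hi, hex i hi]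
      simp
    · rw [hM2 x i hi]
      push Not at hi
      rcases hcov i with h | h
      · rwa [le_antisymm h hi.1]
      · rwa [le_antisymm hi.2 h]
  intro a
  have hadj : M.adjugate.mulVec (M.mulVec x) a = M.det * x a := by
    rw [Matrix.mulVec_mulVec, Matrix.adjugate_mul, Matrix.smul_mulVec, Matrix.one_mulVec]
    simp
  have : d ∣ M.det * x a := by
    rw [← hadj]
    exact Finset.dvd_sum fun i _ => Dvd.dvd.mul_left (hMx i) _
  exact (hd.dvd_or_dvd this).resolve_left hndvd

lemma eqn_all {k : ℕ} (hk : 0 < k) {E : ℤ} (hE : 1 ≤ E)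
    (hfar : ∀ R : Set ℤ, NoAP k R → ∀ u v a b : ℤ, IsGap R u v → a ∈ R → b ∈ R → a < b → b ≤ u →
      u - b ≤ k * (v - u) → v - u ≤ E * (b - a)) {R : Set ℤ} (h : NoAP k R) {d : ℤ}
    (hg : IsGap R 0 d) (w : ℤ) (hw : w ∈ R) (hdw : w < 0 ∨ d < w) :
    ∃ w' l s : ℤ, w' ∈ R ∧ l ∈ R ∧ 1 ≤ s ∧ s ≤ k ∧ (s + 1) * w' - s * w = l ∧
      (d < w → d ≤ w' ∧ w' < w ∧ (∀ x ∈ R, x < w → x ≤ w') ∧ l < w' ∧ -((k * E + 1) * d) ≤ l) ∧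
      (w < 0 → w' ≤ 0 ∧ w < w' ∧ (∀ x ∈ R, w < x → w' ≤ x) ∧ w' < l ∧ l ≤ (k * E + 1) * d) := by
  have hd := hg.1
  rcases hdw with hdw | hdw
  · have hg' : IsGap {x | d - x ∈ R} 0 d := by simpa using gap_reflect hg d
    have h' := h.reflect d
    obtain ⟨w', l, s, h1, h2, h3, h4, h5, h6, h7, h8, h9⟩ := eqn h' hg' hE (hfar _ h') (d - w)
      (by simpa using hw) (by omega)
    refine ⟨d - w', d - l, s, h1, h2, h3, h4, by rw [h8]; ring, fun _ => by omega, fun _ =>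
      ⟨by omega, by omega, ?_, ?_, by linarith⟩⟩
    · intro x hx hwx
      have := h7 (d - x) (by simpa using hx) (by omega)
      omega
    · rw [h8]
      nlinarith
  · obtain ⟨w', l, s, h1, h2, h3, h4, h5, h6, h7, h8, h9⟩ := eqn h hg hE (hfar _ h) w hw hdw
    refine ⟨w', l, s, h1, h2, h3, h4, h8.symm, fun _ => ⟨h5, h6, h7, ?_, ?_⟩, fun _ => by omega⟩
    · rw [h8]
      nlinarith
    · linarith

lemma spaced {k : ℕ} {A E : ℤ} (hE : 1 ≤ E)
    (hfar : ∀ R : Set ℤ, NoAP k R → ∀ u v a b : ℤ, IsGap R u v → a ∈ R → b ∈ R → a < b → b ≤ u →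
      u - b ≤ A * (v - u) → v - u ≤ E * (b - a)) {R : Set ℤ} (h : NoAP k R) {d : ℤ}
    (hg : IsGap R 0 d) (a b : ℤ) (ha : a ∈ R) (hb : b ∈ R) (hab : a < b) (ha' : -(A * d) ≤ a)
    (hb' : b ≤ A * d) : d ≤ E * (b - a) := by
  have hd := hg.1
  have hside : ∀ x ∈ R, x ≤ 0 ∨ d ≤ x := by
    intro x hx
    by_contra! hc
    exact hg.2.2.2 x hc.1 hc.2 hx
  rcases hside b hb with h1 | h1
  · have := hfar R h 0 d a b hg ha hb hab h1 (by linarith)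
    linarith
  · rcases hside a ha with h2 | h2
    · nlinarith
    · have hg' : IsGap {x | d - x ∈ R} 0 d := by simpa using gap_reflect hg d
      have := hfar _ (h.reflect d) 0 d (d - b) (d - a) hg' (by simpa using hb) (by simpa using ha)
        (by omega) (by omega) (by linarith)
      linarith

/-- For every positive integer k there exists p₀ = p₀(k) such that for
every colouring of ℤ with no (2,k)-AP, if [0, d] is a gap and d ≥ p₀ is prime, then
every red integer is a multiple of d. -/
theorem statement13 (k : ℕ) (hk : 0 < k) :
    ∃ p₀ : ℕ, ∀ R : Set ℤ, ¬ HasAPZ R 2 k →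
      ∀ d : ℤ, IsGap R 0 d → Prime d → (p₀ : ℤ) ≤ d →
        ∀ x ∈ R, d ∣ x := by
  classical
  have hk' : (1 : ℤ) ≤ k := by exact_mod_cast hk
  obtain ⟨E, hE, hfar⟩ := far k hk k (by omega)
  obtain ⟨A, hA⟩ : ∃ A : ℤ, A = k * E + 1 := ⟨_, rfl⟩
  have hA1 : 1 ≤ A := by rw [hA]; nlinarith
  obtain ⟨F, hF, hfar2⟩ := far k hk A (by omega)
  obtain ⟨n, hn⟩ : ∃ n : ℕ, n = (2 * (A * F) + 1).toNat := ⟨_, rfl⟩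
  refine ⟨n.factorial * (2 * k + 2) ^ n + k + 2, ?_⟩
  intro R hR d hg hp hd
  push_cast at hd
  have h := noAP_of k R hR
  have hd0 := hg.1
  have hbase0 : (0 : ℤ) ≤ (n.factorial : ℤ) * (2 * k + 2) ^ n := by positivity
  have hkd : (k : ℤ) < d := by linarith
  have heqn := eqn_all hk hE hfar h hg
  rw [← hA] at heqn
  have hsp := spaced hF hfar2 h hg
  have hside : ∀ x ∈ R, x ≤ 0 ∨ d ≤ x := by
    intro x hx
    by_contra! hc
    exact hg.2.2.2 x hc.1 hc.2 hx
  set W : Finset ℤ := (Finset.Icc (-(A * d)) (A * d)).filter (· ∈ R) with hW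
  have memW : ∀ x, x ∈ W ↔ (-(A * d) ≤ x ∧ x ≤ A * d) ∧ x ∈ R := by
    intro x
    simp [hW]
  have hdA : d ≤ A * d := by nlinarith
  have h0W : (0 : ℤ) ∈ W := (memW 0).2 ⟨⟨by omega, by omega⟩, hg.2.1⟩
  have hdW : d ∈ W := (memW d).2 ⟨⟨by omega, by omega⟩, hg.2.2.1⟩
  have hcard : W.card ≤ n := by
    have h1 : W.card ≤ (Finset.Icc (-(A * F)) (A * F)).card := by
      apply Finset.card_le_card_of_injOn (fun w => w * F / d)
      · intro w hw
        obtain ⟨⟨w1, w2⟩, -⟩ := (memW w).1 hw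
        simp only [Finset.coe_Icc, Set.mem_Icc]
        constructor
        · rw [Int.le_ediv_iff_mul_le hd0]
          nlinarith
        · apply Int.ediv_le_of_le_mul hd0
          nlinarith
      · have key : ∀ a ∈ W, ∀ b ∈ W, a * F / d = b * F / d → ¬ a < b := by
          intro a ha b hb hab hlt
          obtain ⟨⟨a1, a2⟩, a3⟩ := (memW a).1 ha
          obtain ⟨⟨b1, b2⟩, b3⟩ := (memW b).1 hb
          have h1 := hsp a b a3 b3 hlt a1 b2
          have h2 := Int.mul_ediv_self_le (x := a * F) (k := d) hd0.ne'
          have h3 := Int.lt_mul_ediv_self_add (x := b * F) (k := d) hd0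
          rw [← hab] at h3
          have h4 := Int.lt_mul_ediv_self_add (x := a * F) (k := d) hd0
          have h5 : a * F / d + 1 ≤ b * F / d := by
            rw [Int.le_ediv_iff_mul_le hd0]
            nlinarith
          omega
        intro a ha b hb hab
        have := key a ha b hb hab
        have := key b hb a ha hab.symm
        omega
    have h2 : (Finset.Icc (-(A * F)) (A * F)).card = n := by
      rw [hn, Int.card_Icc]
      congr 1
      ring
    omega
  have hex : ∀ i : W, ∃ p l : W, ∃ s : ℤ, (0 ≤ s ∧ s ≤ k) ∧
      ((⟨d, hdW⟩ : W) < i → (⟨d, hdW⟩ : W) ≤ p ∧ p < i ∧ (∀ j : W, j < i → j ≤ p) ∧ l < p) ∧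
      (i < (⟨0, h0W⟩ : W) → p ≤ (⟨0, h0W⟩ : W) ∧ i < p ∧ (∀ j : W, i < j → p ≤ j) ∧ p < l) ∧
      (i < (⟨0, h0W⟩ : W) ∨ (⟨d, hdW⟩ : W) < i →
        (s + 1) * (p : ℤ) - s * (i : ℤ) = (l : ℤ)) := by
    rintro ⟨w, hw⟩
    obtain ⟨⟨w1, w2⟩, w3⟩ := (memW w).1 hw
    by_cases hc : w < 0 ∨ d < w
    · obtain ⟨w', l, s, e1, e2, e3, e4, e5, e6, e7⟩ := heqn w w3 hc
      have hw' : w' ∈ W := (memW w').2 ⟨by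
        rcases hc with hc | hc
        · have := e7 hc
          constructor <;> linarith
        · have := e6 hc
          constructor <;> linarith, e1⟩
      have hl : l ∈ W := (memW l).2 ⟨by
        rcases hc with hc | hc
        · have := e7 hc
          constructor <;> linarith
        · have := e6 hc
          constructor <;> linarith, e2⟩
      refine ⟨⟨w', hw'⟩, ⟨l, hl⟩, s, ⟨by omega, e4⟩, ?_, ?_, fun _ => e5⟩
      · intro hi
        obtain ⟨f1, f2, f3, f4, -⟩ := e6 hi
        exact ⟨f1, f2, fun j hj => f3 j ((memW _).1 j.2).2 hj, f4⟩
      · intro hi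
        obtain ⟨f1, f2, f3, f4, -⟩ := e7 hi
        exact ⟨f1, f2, fun j hj => f3 j ((memW _).1 j.2).2 hj, f4⟩
    · refine ⟨⟨w, hw⟩, ⟨w, hw⟩, 0, ⟨le_rfl, by omega⟩, fun hi => absurd (Or.inr hi) hc,
        fun hi => absurd (Or.inl hi) hc, fun hi => absurd hi hc⟩
  choose p l s hs hRt hLt heq using hex
  have hwin : ∀ a : W, d ∣ (a : ℤ) :=
    alg (fun i : W => (i : ℤ)) (fun a b hab => hab) ⟨0, h0W⟩ ⟨d, hdW⟩ hd0
      (fun i => hside i ((memW _).1 i.2).2) p l s k hs hRt hLt heq n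
      (by simpa using hcard) d hp (by linarith) (dvd_zero d) (dvd_refl d)
  -- propagate outside the window
  have hall : ∀ m : ℕ, ∀ x ∈ R, x.natAbs = m → d ∣ x := by
    intro m
    induction m using Nat.strong_induction_on with
    | _ m ih =>
      intro x hx hxm
      by_cases hxW : x ∈ W
      · exact hwin ⟨x, hxW⟩
      have hxb : x < -(A * d) ∨ A * d < x := by
        by_contra! hc
        exact hxW ((memW x).2 ⟨hc, hx⟩)
      have hc : x < 0 ∨ d < x := by omega
      obtain ⟨w', l, s, e1, e2, e3, e4, e5, e6, e7⟩ := heqn x hx hc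
      have hw' : w'.natAbs < m ∧ l.natAbs < m := by
        rcases hc with hc | hc
        · have := e7 hc
          omega
        · have := e6 hc
          omega
      have d1 := ih _ hw'.1 w' e1 rfl
      have d2 := ih _ hw'.2 l e2 rfl
      have d3 : d ∣ s * x := by
        have : s * x = (s + 1) * w' - l := by linarith
        rw [this]
        exact dvd_sub (d1.mul_left _) d2
      rcases hp.dvd_or_dvd d3 with d4 | d4
      · have := Int.le_of_dvd (by omega) d4
        omega
      · exact d4
  exact fun x hx => hall _ x hx rfl
end

section
/- For every positive integer k and every prime p there exists a positive integer n_p such that the following holds: for every red–blue colouring of ℤ containing no (2,k)-AP, if [0, d] is a gap and p^(n_p) divides d, then there exists an arithmetic progression in ℤ with common difference p and at least d terms, all of whose terms are blue. -/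
open Classical in
/-- The red elements of an integer interval. -/
noncomputable def redsIn (R : Set ℤ) (a b : ℤ) : Finset ℤ := (Finset.Icc a b).filter (· ∈ R)

lemma mem_redsIn {R : Set ℤ} {a b x : ℤ} : x ∈ redsIn R a b ↔ (a ≤ x ∧ x ≤ b) ∧ x ∈ R := by
  simp [redsIn]

/-- Any two distinct red points extend to a third one within `k` steps. -/
lemma red_extend {R : Set ℤ} {k : ℕ} (h : ¬ HasAPZ R 2 k) {r s : ℤ} (hr : r ∈ R) (hs : s ∈ R)
    (hne : r ≠ s) : ∃ j : ℤ, 1 ≤ j ∧ j ≤ k ∧ s + j * (s - r) ∈ R := by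
  by_contra hcon
  push Not at hcon
  apply h
  refine ⟨r, s - r, sub_ne_zero.mpr hne.symm, ?_, ?_⟩
  · intro i hi
    interval_cases i
    · simpa using hr
    · simpa using hs
  · intro i h1 h2
    have := hcon ((i : ℤ) - 1) (by omega) (by omega)
    have e : r + (i : ℤ) * (s - r) = s + ((i : ℤ) - 1) * (s - r) := by ring
    rw [e]; exact this

/-- One step of the counting argument: passing from `[0,e]` to `[0,e']`. -/
lemma count_step {R : Set ℤ} {k : ℕ} (h : ¬ HasAPZ R 2 k) {d : ℤ} (hg : IsGap R 0 d)
    {e e' : ℤ} (hde : d ≤ e) (hee : e ≤ e') (hstep : (k : ℤ) * (k + 1) * (e' - e) ≤ d) {N : ℕ}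
    (hN : (redsIn R 0 e).card ≤ N) : (redsIn R 0 e').card ≤ N + (k * N + 1) := by
  classical
  obtain ⟨hd0, -, hdR, -⟩ := hg
  have hsub : redsIn R 0 e' ⊆ redsIn R 0 e ∪ redsIn R (e + 1) e' := by
    intro x hx
    rw [mem_redsIn] at hx
    rw [Finset.mem_union, mem_redsIn, mem_redsIn]
    by_cases hxe : x ≤ e
    · exact Or.inl ⟨⟨hx.1.1, hxe⟩, hx.2⟩
    · exact Or.inr ⟨⟨by omega, hx.1.2⟩, hx.2⟩
  have key : (redsIn R (e + 1) e').card ≤ k * N + 1 := by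
    -- the last red element in `[d, e]`
    obtain ⟨r, hr, hrmax⟩ := (redsIn R d e).exists_max_image id
      ⟨d, mem_redsIn.mpr ⟨⟨le_rfl, hde⟩, hdR⟩⟩
    rw [mem_redsIn] at hr
    by_cases hc : e - r ≤ k * (e' - e)
    · have hj : ∀ b ∈ redsIn R (e + 1) e', ∃ j : ℤ, 1 ≤ j ∧ j ≤ k ∧ r + j * (r - b) ∈ R := by
        intro b hb
        rw [mem_redsIn] at hb
        exact red_extend h hb.2 hr.2 (by omega)
      choose! J hJ1 hJ2 hJ3 using hj
      have hcard : (redsIn R (e + 1) e').card ≤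
          ((Finset.Icc (1 : ℤ) k) ×ˢ (redsIn R 0 e)).card := by
        apply Finset.card_le_card_of_injOn (fun b => (J b, r + J b * (r - b)))
        · intro b hb
          have hb' := mem_redsIn.mp hb
          have h1 := hJ1 b hb
          have h2 := hJ2 b hb
          have h3 := hJ3 b hb
          simp only [Finset.coe_product, Set.mem_prod, Finset.mem_coe, Finset.mem_Icc]
          refine ⟨⟨h1, h2⟩, mem_redsIn.mpr ⟨⟨?_, ?_⟩, h3⟩⟩
          · have : J b * (b - r) ≤ k * (b - r) :=
              mul_le_mul_of_nonneg_right h2 (by omega)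
            have h4 : (k : ℤ) * (b - r) ≤ k * ((k + 1) * (e' - e)) :=
              mul_le_mul_of_nonneg_left (by linarith) (by positivity)
            nlinarith
          · have : 0 ≤ J b * (b - r) := mul_nonneg (by omega) (by omega)
            nlinarith
        · intro b hb b' hb' hbb
          simp only [Prod.mk.injEq] at hbb
          obtain ⟨e1, e2⟩ := hbb
          rw [← e1] at e2
          have h1 := hJ1 b hb
          have : J b * (b - b') = 0 := by linarith
          rcases mul_eq_zero.mp this with h5 | h5 <;> omega
      rw [Finset.card_product] at hcard
      simp only [Int.card_Icc, add_sub_cancel_right, Int.toNat_natCast] at hcard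
      have : k * (redsIn R 0 e).card ≤ k * N := Nat.mul_le_mul_left _ hN
      omega
    · push Not at hc
      have : (redsIn R (e + 1) e').card ≤ 1 := by
        by_contra hlt
        push Not at hlt
        obtain ⟨b, hb, hbmin⟩ := (redsIn R (e + 1) e').exists_min_image id
          (Finset.card_pos.mp (by omega))
        obtain ⟨b', hb', hne⟩ := Finset.exists_mem_ne hlt b
        have hle : b ≤ b' := hbmin b' hb'
        rw [mem_redsIn] at hb hb'
        obtain ⟨j, hj1, hj2, hj3⟩ := red_extend h hb'.2 hb.2 hne
        have hlt' : b < b' := lt_of_le_of_ne hle (Ne.symm hne)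
        have h1 : j * (b' - b) ≤ k * (e' - e) :=
          mul_le_mul hj2 (by omega) (by omega) (by positivity)
        have h2 : 0 < j * (b' - b) := mul_pos (by omega) (by omega)
        have h3 : j * (b - b') = - (j * (b' - b)) := by ring
        rw [h3] at hj3
        by_cases hle2 : b + -(j * (b' - b)) ≤ e
        · have := hrmax _ (mem_redsIn.mpr ⟨⟨by omega, hle2⟩, hj3⟩)
          simp only [id] at this
          omega
        · have := hbmin _ (mem_redsIn.mpr ⟨⟨by omega, by omega⟩, hj3⟩)
          simp only [id] at this
          omega
      omega
  calc (redsIn R 0 e').card ≤ _ := Finset.card_le_card hsub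
    _ ≤ _ := Finset.card_union_le _ _
    _ ≤ _ := Nat.add_le_add hN key

lemma count_iter (k : ℕ) (i : ℕ) : ∃ N : ℕ, ∀ R : Set ℤ, ¬ HasAPZ R 2 k → ∀ d δ : ℤ,
    IsGap R 0 d → 0 ≤ δ → (k : ℤ) * (k + 1) * δ ≤ d → (redsIn R 0 (d + i * δ)).card ≤ N := by
  induction i with
  | zero =>
    refine ⟨2, fun R h d δ hg hδ hK => ?_⟩
    have : redsIn R 0 (d + (0 : ℕ) * δ) ⊆ {0, d} := by
      intro x hx
      rw [mem_redsIn] at hx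
      have := hg.2.2.2 x
      simp only [Finset.mem_insert, Finset.mem_singleton]
      simp only [Nat.cast_zero, zero_mul, add_zero] at hx
      by_contra hcon
      push Not at hcon
      exact this (by omega) (by omega) hx.2
    exact (Finset.card_le_card this).trans Finset.card_le_two
  | succ i ih =>
    obtain ⟨N, hN⟩ := ih
    refine ⟨N + (k * N + 1), fun R h d δ hg hδ hK => ?_⟩
    have h0 : 0 ≤ (i : ℤ) * δ := by positivity
    refine count_step h hg (e := d + i * δ) (by omega) ?_ ?_ (hN R h d δ hg hδ hK)
    · push_cast; linarith
    · push_cast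
      have : d + ((i : ℤ) + 1) * δ - (d + i * δ) = δ := by ring
      rw [this]; exact hK

lemma count_right (k C : ℕ) (hk : 0 < k) : ∃ N : ℕ, ∀ R : Set ℤ, ¬ HasAPZ R 2 k → ∀ d : ℤ,
    IsGap R 0 d → (k : ℤ) * (k + 1) ≤ d → (redsIn R 0 (C * d)).card ≤ N := by
  obtain ⟨N, hN⟩ := count_iter k (2 * (k * (k + 1)) * C)
  refine ⟨N, fun R h d hg hd => ?_⟩
  set K : ℤ := (k : ℤ) * (k + 1) with hKdef
  have hKpos : 0 < K := by positivity
  have hdm := Int.mul_ediv_add_emod d K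
  have hm0 := Int.emod_nonneg d hKpos.ne'
  have hm1 := Int.emod_lt_of_pos d hKpos
  have hδ : 1 ≤ d / K := (Int.le_ediv_iff_mul_le hKpos).mpr (by linarith)
  have := hN R h d (d / K) hg (by omega) (by linarith)
  refine (Finset.card_le_card ?_).trans this
  intro x hx
  rw [mem_redsIn] at hx ⊢
  refine ⟨⟨hx.1.1, hx.1.2.trans ?_⟩, hx.2⟩
  have h2 : d ≤ 2 * (K * (d / K)) := by nlinarith
  have h3 : (C : ℤ) * d ≤ C * (2 * (K * (d / K))) := mul_le_mul_of_nonneg_left h2 (by positivity)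
  push_cast
  rw [← hKdef]
  nlinarith [hg.1]

lemma reflect_noAP {R : Set ℤ} {k : ℕ} (h : ¬ HasAPZ R 2 k) (d : ℤ) :
    ¬ HasAPZ {x | d - x ∈ R} 2 k := by
  rintro ⟨x, e, he, h1, h2⟩
  apply h
  refine ⟨d - x, -e, by simpa using he, ?_, ?_⟩
  · intro i hi
    have := h1 i hi
    simp only [Set.mem_setOf_eq] at this
    convert this using 1; ring
  · intro i hi hi'
    have := h2 i hi hi'
    simp only [Set.mem_setOf_eq] at this
    convert this using 2; ring

lemma count_both (k C : ℕ) (hk : 0 < k) : ∃ N : ℕ, ∀ R : Set ℤ, ¬ HasAPZ R 2 k → ∀ d : ℤ,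
    IsGap R 0 d → (k : ℤ) * (k + 1) ≤ d → (redsIn R (d - C * d) (C * d)).card ≤ N := by
  classical
  obtain ⟨N, hN⟩ := count_right k C hk
  refine ⟨N + N, fun R h d hg hd => ?_⟩
  have h1 := hN R h d hg hd
  have hg' : IsGap {x | d - x ∈ R} 0 d := by
    refine ⟨hg.1, by simpa using hg.2.2.1, by simpa using hg.2.1, fun n h1 h2 => ?_⟩
    exact hg.2.2.2 (d - n) (by omega) (by omega)
  have h2 := hN _ (reflect_noAP h d) d hg' hd
  have hsub : redsIn R (d - C * d) (C * d) ⊆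
      redsIn R 0 (C * d) ∪ (redsIn {x | d - x ∈ R} 0 (C * d)).image (fun x => d - x) := by
    intro x hx
    rw [mem_redsIn] at hx
    rw [Finset.mem_union, mem_redsIn, Finset.mem_image]
    by_cases hx0 : 0 ≤ x
    · exact Or.inl ⟨⟨hx0, hx.1.2⟩, hx.2⟩
    · refine Or.inr ⟨d - x, mem_redsIn.mpr ⟨⟨?_, by omega⟩, by simpa using hx.2⟩, by ring⟩
      have := hg.1
      omega
  calc _ ≤ _ := Finset.card_le_card hsub
    _ ≤ _ := Finset.card_union_le _ _
    _ ≤ _ := Nat.add_le_add h1 (Finset.card_image_le.trans h2)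

/-- Simultaneous Dirichlet approximation modulo `q`. -/
lemma dirichlet_mod (F : Finset ℤ) (M q : ℕ) (hM : 0 < M) (hq : M ^ F.card < q) :
    ∃ (c : ℤ) (f : ℤ → ℤ), c ≠ 0 ∧ |c| < q ∧ (∀ x, (q : ℤ) ∣ f x - c * x) ∧
      (∀ x, (q : ℤ) ∣ x → f x = 0) ∧ ∀ x ∈ F, M * |f x| < q := by
  have hq0 : (0 : ℤ) < q := by exact_mod_cast (Nat.zero_le _).trans_lt hq
  have hM0 : (0 : ℤ) < M := by exact_mod_cast hM
  have hlt : ∀ z : ℤ, ((M * (z % q)) / q).toNat < M := by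
    intro z
    have h1 := Int.emod_lt_of_pos z hq0
    have : (M * (z % q)) / (q : ℤ) < M := by
      apply Int.ediv_lt_of_lt_mul hq0
      exact mul_lt_mul_of_pos_left h1 hM0
    omega
  let φ : Fin q → (F → Fin M) := fun l x => ⟨((M * (((l : ℕ) : ℤ) * (x : ℤ) % q)) / q).toNat, hlt _⟩
  obtain ⟨l1, l2, hne, heq⟩ := Fintype.exists_ne_map_eq_of_card_lt φ (by simpa using hq)
  have hne' : ((l1 : ℕ) : ℤ) ≠ ((l2 : ℕ) : ℤ) := by
    intro hh
    exact hne (Fin.ext (by exact_mod_cast hh))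
  have b1 := l1.isLt
  have b2 := l2.isLt
  refine ⟨((l1 : ℕ) : ℤ) - ((l2 : ℕ) : ℤ),
    fun x => ((l1 : ℕ) : ℤ) * x % q - ((l2 : ℕ) : ℤ) * x % q, sub_ne_zero.mpr hne', ?_, ?_, ?_, ?_⟩
  · rw [abs_lt]; constructor <;> omega
  · intro x
    have h1 := Int.mul_ediv_add_emod (((l1 : ℕ) : ℤ) * x) q
    have h2 := Int.mul_ediv_add_emod (((l2 : ℕ) : ℤ) * x) q
    refine ⟨((l2 : ℕ) : ℤ) * x / q - ((l1 : ℕ) : ℤ) * x / q, ?_⟩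
    linarith
  · intro x hx
    simp only
    rw [Int.emod_eq_zero_of_dvd (Dvd.dvd.mul_left hx _), Int.emod_eq_zero_of_dvd (Dvd.dvd.mul_left hx _)]
    rfl
  · intro x hx
    have h := congrArg Fin.val (congrFun heq ⟨x, hx⟩)
    simp only [φ] at h
    set u := ((l1 : ℕ) : ℤ) * x % q
    set v := ((l2 : ℕ) : ℤ) * x % q
    have hu : 0 ≤ u := Int.emod_nonneg _ hq0.ne'
    have hv : 0 ≤ v := Int.emod_nonneg _ hq0.ne'
    have hu' : 0 ≤ M * u / q := Int.ediv_nonneg (by positivity) hq0.le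
    have hv' : 0 ≤ M * v / q := Int.ediv_nonneg (by positivity) hq0.le
    have h' : M * u / q = M * v / q := by omega
    have e1 := Int.mul_ediv_add_emod (M * u) q
    have e2 := Int.mul_ediv_add_emod (M * v) q
    have m1 := Int.emod_nonneg (M * u) hq0.ne'
    have m2 := Int.emod_nonneg (M * v) hq0.ne'
    have n1 := Int.emod_lt_of_pos (M * u) hq0
    have n2 := Int.emod_lt_of_pos (M * v) hq0
    rw [h'] at e1
    have : (M : ℤ) * |u - v| = |M * u - M * v| := by
      rw [← mul_sub, abs_mul, abs_of_pos hM0]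
    rw [this, abs_lt]
    constructor <;> linarith

/-- Maximum principle: a function on the red points compatible with the extension property is
affine in the middle of the window. -/
lemma max_principle {R : Set ℤ} {k : ℕ} (h : ¬ HasAPZ R 2 k) (G a b : ℤ)
    (hG : ∀ x : ℤ, ∃ y ∈ R, x ≤ y ∧ y < x + G) (f : ℤ → ℤ)
    (hf : ∀ r ∈ redsIn R a b, ∀ s ∈ redsIn R a b, ∀ j : ℤ, 1 ≤ j → j ≤ k →
      s + j * (s - r) ∈ redsIn R a b → f (s + j * (s - r)) - f s = j * (f s - f r))
    (r₁ r₂ : ℤ) (hr₁ : r₁ ∈ redsIn R a b) (hr₂ : r₂ ∈ redsIn R a b) (h12 : r₁ < r₂) :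
    ∃ m c : ℚ, ∀ x ∈ redsIn R a b, a + k * G ≤ x → x ≤ b - k * G → (f x : ℚ) = m * x + c := by
  classical
  set F := redsIn R a b with hF
  have hGpos : 0 < G := by
    obtain ⟨y, -, h1, h2⟩ := hG 0
    omega
  let P := (F ×ˢ F).filter (fun z => z.1 < z.2)
  obtain ⟨⟨r₀, s₀⟩, hz, hmax⟩ := P.exists_max_image
    (fun z => ((f z.2 : ℚ) - f z.1) / ((z.2 : ℚ) - z.1)) ⟨(r₁, r₂), by simp [P, hr₁, hr₂, h12]⟩
  simp only [P, Finset.mem_filter, Finset.mem_product] at hz hmax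
  set m : ℚ := ((f s₀ : ℚ) - f r₀) / ((s₀ : ℚ) - r₀) with hm
  let H : ℤ → ℚ := fun x => f x - m * x
  have hanti : ∀ x ∈ F, ∀ y ∈ F, x ≤ y → H y ≤ H x := by
    intro x hx y hy hxy
    rcases hxy.eq_or_lt with rfl | hlt
    · exact le_rfl
    have := hmax (x, y) ⟨⟨hx, hy⟩, hlt⟩
    have hpos : (0 : ℚ) < (y : ℚ) - x := by
      rw [sub_pos]; exact_mod_cast hlt
    rw [div_le_iff₀ hpos] at this
    simp only [H]
    linarith
  have hHeq : H r₀ = H s₀ := by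
    have hpos : (0 : ℚ) < (s₀ : ℚ) - r₀ := by
      rw [sub_pos]; exact_mod_cast hz.2
    have : m * ((s₀ : ℚ) - r₀) = f s₀ - f r₀ := div_mul_cancel₀ _ hpos.ne'
    simp only [H]
    linarith
  have hext : ∀ r ∈ F, ∀ s ∈ F, ∀ j : ℤ, 1 ≤ j → j ≤ k → s + j * (s - r) ∈ F → H r = H s →
      H (s + j * (s - r)) = H s := by
    intro r hr s hs j hj1 hj2 ht he
    have e := hf r hr s hs j hj1 hj2 ht
    have e' : (f (s + j * (s - r)) : ℚ) - f s = j * (f s - f r) := by exact_mod_cast e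
    simp only [H] at he ⊢
    push_cast
    have : (f s : ℚ) - f r = m * (s - r) := by linarith
    rw [this] at e'
    linarith
  -- leftmost element that starts a pair of maximal slope
  let Q := F.filter (fun r => ∃ s ∈ F, r < s ∧ H r = H s)
  obtain ⟨r, hr, hrmin⟩ := Q.exists_min_image id
    ⟨r₀, by simp only [Q, Finset.mem_filter]; exact ⟨hz.1.1, s₀, hz.1.2, hz.2, hHeq⟩⟩
  simp only [Q, Finset.mem_filter, id] at hr hrmin
  obtain ⟨hrF, s, hsF, hrs, hHrs⟩ := hr
  have hrF' := mem_redsIn.mp hrF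
  have hsF' := mem_redsIn.mp hsF
  -- we may take the partner within distance `G`
  obtain ⟨s', hs'F, hrs', hHrs', hs'G⟩ : ∃ s' ∈ F, r < s' ∧ H r = H s' ∧ s' - r ≤ G := by
    obtain ⟨y, hyR, hy1, hy2⟩ := hG (r + 1)
    by_cases hys : y ≤ s
    · have hyF : y ∈ F := mem_redsIn.mpr ⟨⟨by omega, by omega⟩, hyR⟩
      refine ⟨y, hyF, by omega, le_antisymm ?_ (hanti r hrF y hyF (by omega)), by omega⟩
      rw [hHrs]
      exact hanti y hyF s hsF hys
    · exact ⟨s, hsF, hrs, hHrs, by omega⟩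
  have hs'F' := mem_redsIn.mp hs'F
  have hrleft : r < a + k * G := by
    by_contra hcon
    push Not at hcon
    obtain ⟨j, hj1, hj2, hj3⟩ := red_extend h hs'F'.2 hrF'.2 (by omega)
    have h1 : j * (s' - r) ≤ k * G := mul_le_mul hj2 hs'G (by omega) (by positivity)
    have h2 : 0 < j * (s' - r) := mul_pos (by omega) (by omega)
    have h3 : j * (r - s') = - (j * (s' - r)) := by ring
    have htF : r + j * (r - s') ∈ F := by
      refine mem_redsIn.mpr ⟨⟨?_, ?_⟩, hj3⟩ <;> rw [h3] <;> omega
    have e := hext s' hs'F r hrF j hj1 hj2 htF hHrs'.symm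
    have := hrmin _ ⟨htF, r, hrF, by omega, e⟩
    omega
  -- rightmost element on the same line
  obtain ⟨x, hx, hxmax⟩ := (F.filter (fun x => H x = H r)).exists_max_image id
    ⟨s', by simp [hs'F, hHrs']⟩
  have hs'x := hxmax s' (by simp [hs'F, hHrs'])
  simp only [Finset.mem_filter, id] at hx hxmax hs'x
  have hxF' := mem_redsIn.mp hx.1
  have hxright : b - k * G < x := by
    by_contra hcon
    push Not at hcon
    obtain ⟨x', hx'F, hx'x, hx'r, hx'G⟩ : ∃ x' ∈ F, x' < x ∧ r ≤ x' ∧ x - x' ≤ G := by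
      by_cases hc : x - G ≤ r
      · exact ⟨r, hrF, by omega, le_rfl, by omega⟩
      · obtain ⟨y, hyR, hy1, hy2⟩ := hG (x - G)
        exact ⟨y, mem_redsIn.mpr ⟨⟨by omega, by omega⟩, hyR⟩, by omega, by omega, by omega⟩
    have hHx' : H x' = H x := by
      refine le_antisymm ?_ (hanti x' hx'F x hx.1 hx'x.le)
      rw [hx.2]
      exact hanti r hrF x' hx'F hx'r
    obtain ⟨j, hj1, hj2, hj3⟩ := red_extend h (mem_redsIn.mp hx'F).2 hxF'.2 hx'x.ne
    have h1 : j * (x - x') ≤ k * G := mul_le_mul hj2 hx'G (by omega) (by positivity)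
    have h2 : 0 < j * (x - x') := mul_pos (by omega) (by omega)
    have htF : x + j * (x - x') ∈ F := mem_redsIn.mpr ⟨⟨by omega, by omega⟩, hj3⟩
    have e := hext x' hx'F x hx.1 j hj1 hj2 htF hHx'
    have := hxmax _ ⟨htF, e.trans hx.2⟩
    omega
  refine ⟨m, H r, fun y hy hy1 hy2 => ?_⟩
  have : H y = H r := by
    refine le_antisymm (hanti r hrF y hy (by omega)) ?_
    rw [← hx.2]
    exact hanti y hy x hx.1 (by omega)
  rw [← this]
  simp only [H]
  ring

theorem statement14 (k : ℕ) (hk : 0 < k) (p : ℕ) (hp : p.Prime) :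
    ∃ np : ℕ, 0 < np ∧ ∀ R : Set ℤ, ¬ HasAPZ R 2 k →
      ∀ d : ℤ, IsGap R 0 d → (p : ℤ) ^ np ∣ d →
        ∃ a : ℤ, ∀ i : ℤ, 0 ≤ i → i < d → a + i * p ∉ R := by
  obtain ⟨N, hN⟩ := count_both k ((k + 1) * p + 1) hk
  set n := (2 * k + 3) ^ N + k * (k + 1) with hn
  refine ⟨n, by positivity, fun R h d hg hdvd => ?_⟩
  by_contra hcon
  push Not at hcon
  have hp2 := hp.two_le
  have hnq : n < p ^ n := Nat.lt_pow_self hp.one_lt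
  have hd0 := hg.1
  have hqd : ((p ^ n : ℕ) : ℤ) ≤ d := Int.le_of_dvd hd0 (by exact_mod_cast hdvd)
  have hdK : (k : ℤ) * (k + 1) ≤ d := by
    have : k * (k + 1) ≤ p ^ n := by omega
    have : ((k * (k + 1) : ℕ) : ℤ) ≤ ((p ^ n : ℕ) : ℤ) := by exact_mod_cast this
    push_cast at this hqd
    linarith
  have hcard := hN R h d hg hdK
  set G : ℤ := p * d with hGdef
  have hdG : d ≤ G := by
    have : (2 : ℤ) ≤ p := by exact_mod_cast hp2
    nlinarith
  set a : ℤ := d - (((k + 1) * p + 1 : ℕ) : ℤ) * d with ha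
  set b : ℤ := (((k + 1) * p + 1 : ℕ) : ℤ) * d with hb
  have ha' : a = - ((k : ℤ) * G) - G := by rw [ha, hb, hGdef]; push_cast; ring
  have hb' : b = (k : ℤ) * G + G + d := by rw [hb, hGdef]; push_cast; ring
  have hkG : 0 ≤ (k : ℤ) * G := mul_nonneg (by positivity) (by omega)
  obtain ⟨c, f, hc0, hcq, hfc, hf0, hfs⟩ := dirichlet_mod (redsIn R a b) (2 * k + 3) (p ^ n)
    (by omega) (by
      have := Nat.pow_le_pow_right (show 0 < 2 * k + 3 by omega) hcard
      omega)
  have hG : ∀ x : ℤ, ∃ y ∈ R, x ≤ y ∧ y < x + G := by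
    intro x
    obtain ⟨i, hi0, hid, hi⟩ := hcon x
    have hpp : (0 : ℤ) < p := by omega
    refine ⟨_, hi, by nlinarith, ?_⟩
    rw [hGdef]; nlinarith
  obtain ⟨i, hi0, hid, hi⟩ := hcon 1
  set y : ℤ := 1 + i * p with hy
  have hyb : 0 ≤ y ∧ y ≤ G := by
    have hpp : (1 : ℤ) ≤ p := by omega
    rw [hy, hGdef]
    constructor
    · nlinarith
    · nlinarith
  have h0F : (0 : ℤ) ∈ redsIn R a b := mem_redsIn.mpr ⟨⟨by omega, by omega⟩, hg.2.1⟩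
  have hdF : d ∈ redsIn R a b := mem_redsIn.mpr ⟨⟨by omega, by omega⟩, hg.2.2.1⟩
  have hyF : y ∈ redsIn R a b := mem_redsIn.mpr ⟨⟨by omega, by omega⟩, hi⟩
  obtain ⟨m, e, hme⟩ := max_principle h G a b hG f (by
    intro r hr s hs j hj1 hj2 ht
    have d1 := hfc r
    have d2 := hfc s
    have d3 := hfc (s + j * (s - r))
    have b1 := hfs r hr
    have b2 := hfs s hs
    have b3 := hfs _ ht
    set t := s + j * (s - r) with htdef
    have hdv : ((p ^ n : ℕ) : ℤ) ∣ f t - f s - j * (f s - f r) := by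
      have e1 : f t - f s - j * (f s - f r) =
          (f t - c * t) - (f s - c * s) - j * ((f s - c * s) - (f r - c * r)) := by
        rw [htdef]; ring
      rw [e1]
      exact dvd_sub (dvd_sub d3 d2) (Dvd.dvd.mul_left (dvd_sub d2 d1) _)
    have hq0 : (0 : ℤ) < ((p ^ n : ℕ) : ℤ) := by
      have : 0 < p ^ n := by omega
      exact_mod_cast this
    generalize ((p ^ n : ℕ) : ℤ) = q at *
    have hz : f t - f s - j * (f s - f r) = 0 := by
      apply Int.eq_zero_of_abs_lt_dvd hdv
      have t1 : |f t - f s - j * (f s - f r)| ≤ |f t| + |f s| + k * (|f s| + |f r|) := by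
        have u1 : |f t - f s - j * (f s - f r)| ≤ |f t - f s| + |j * (f s - f r)| := abs_sub _ _
        have u2 : |f t - f s| ≤ |f t| + |f s| := abs_sub _ _
        have u3 : |f s - f r| ≤ |f s| + |f r| := abs_sub _ _
        rw [abs_mul, abs_of_nonneg (by omega : 0 ≤ j)] at u1
        have u4 : j * |f s - f r| ≤ k * (|f s| + |f r|) :=
          mul_le_mul hj2 u3 (abs_nonneg _) (by positivity)
        linarith
      have hkp : (0 : ℤ) ≤ k := by positivity
      push_cast at b1 b2 b3
      have hpos : (0 : ℤ) < 2 * k + 3 := by positivity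
      refine lt_of_mul_lt_mul_left (a := (2 * (k : ℤ) + 3)) ?_ hpos.le
      have v1 := mul_le_mul_of_nonneg_left t1 hpos.le
      have v2 := mul_le_mul_of_nonneg_left b1.le hkp
      have v3 := mul_le_mul_of_nonneg_left b2.le hkp
      nlinarith
    linarith) 0 d h0F hdF hd0
  have e0 := hme 0 h0F (by omega) (by omega)
  have ed := hme d hdF (by omega) (by omega)
  have ey := hme y hyF (by omega) (by omega)
  rw [hf0 0 (dvd_zero _)] at e0
  rw [hf0 d (by exact_mod_cast hdvd)] at ed
  have he0 : e = 0 := by simpa using e0.symm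
  have hm0 : m = 0 := by
    rw [he0] at ed
    have : (d : ℚ) ≠ 0 := by exact_mod_cast hd0.ne'
    simpa [this] using ed.symm
  rw [he0, hm0] at ey
  have hfy : f y = 0 := by simpa using ey
  have hdc := hfc y
  rw [hfy, zero_sub, dvd_neg] at hdc
  have hcop : IsCoprime (((p ^ n : ℕ) : ℤ)) y := by
    push_cast
    apply IsCoprime.pow_left
    exact ⟨-i, 1, by rw [hy]; ring⟩
  have := hcop.dvd_of_dvd_mul_right hdc
  exact hc0 (Int.eq_zero_of_abs_lt_dvd this hcq)
end
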